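/- arXiv:2103.02888 — 2 statements merged into one kernel-verified Lean document; each statement's English description precedes it below -/
import Mathlib

section
/- Existence of Boozer coordinates near a regular flux surface: Let B : U → ℝ³ and p : U → ℝ be C^∞ on an open set U ⊆ ℝ³ with B nowhere vanishing, div B = 0, and (curl B) × B = ∇p on U (MHS integrability). Let c ∈ ℝ and let Λ be a compact connected component of p⁻¹(c) with ∇p(z) ≠ 0 for every z ∈ Λ. Then there exist real numbers ψ₁ < ψ₂, a C^∞ map Φ : (ψ₁,ψ₂) × ℝ² → U that is 2π-periodic in each of its last two arguments, has everywhere invertible differential, has image an open neighborhood of Λ, and satisfies Φ(ψ,θ,ζ) = Φ(ψ',θ',ζ') iff ψ = ψ', θ − θ' ∈ 2πℤ and ζ − ζ' ∈ 2πℤ; and C^∞ functions P, f, g, k, l : (ψ₁,ψ₂) → ℝ such that for all (ψ,θ,ζ): p(Φ(ψ,θ,ζ)) = P(ψ), det(DΦ) · (DΦ)⁻¹ (B∘Φ) = (0, g′(ψ), f′(ψ)), and det(DΦ) · (DΦ)⁻¹ ((B × ∇p)∘Φ) = (0, l′(ψ), k′(ψ)) at (ψ,θ,ζ). -/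
noncomputable section

open RealInnerProductSpace

/-- `ℝ³` as a Euclidean space. -/
abbrev R3 : Type := EuclideanSpace ℝ (Fin 3)

/-- The point `(x, y, z)` of `ℝ³`. -/
def pt (x y z : ℝ) : R3 := !₂[x, y, z]

/-- Divergence of a vector field: the trace of its derivative. -/
def divg (v : R3 → R3) (z : R3) : ℝ :=
  LinearMap.trace ℝ R3 (fderiv ℝ v z).toLinearMap

/-- Cross product on `ℝ³`. -/
def cross3 (u v : R3) : R3 :=
  pt (u 1 * v 2 - u 2 * v 1) (u 2 * v 0 - u 0 * v 2) (u 0 * v 1 - u 1 * v 0)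

/-- Standard basis vectors of `ℝ³`. -/
def e3 (i : Fin 3) : R3 := EuclideanSpace.single i 1

/-- Curl of a vector field on `ℝ³`. -/
def curl (v : R3 → R3) (z : R3) : R3 :=
  pt (fderiv ℝ v z (e3 1) 2 - fderiv ℝ v z (e3 2) 1)
     (fderiv ℝ v z (e3 2) 0 - fderiv ℝ v z (e3 0) 2)
     (fderiv ℝ v z (e3 0) 1 - fderiv ℝ v z (e3 1) 0)

/-- The Hessian of `p` at `z`, as a bilinear form. -/
def hess (p : R3 → ℝ) (z : R3) (u v : R3) : ℝ :=
  (iteratedFDeriv ℝ 2 p z) ![u, v]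

/-- `γ` is the image of a periodic integral curve of `B` lying in `U`. -/
def IsPeriodicOrbit (U : Set R3) (B : R3 → R3) (γ : Set R3) : Prop :=
  ∃ (c : ℝ → R3) (T : ℝ), 0 < T ∧ (∀ t, c t ∈ U) ∧
    (∀ t, c (t + T) = c t) ∧ (∀ t, HasDerivAt c (B (c t)) t) ∧ Set.range c = γ

/-- An integrable magnetic field `(B, J, p)` on an open set `U ⊆ ℝ³`. -/
structure IntegrableMagneticField (U : Set R3) (B J : R3 → R3) (p : R3 → ℝ) : Prop where
  isOpen_U : IsOpen U
  smooth_B : ContDiffOn ℝ (⊤ : ℕ∞) B U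
  smooth_J : ContDiffOn ℝ (⊤ : ℕ∞) J U
  smooth_p : ContDiffOn ℝ (⊤ : ℕ∞) p U
  B_ne_zero : ∀ z ∈ U, B z ≠ 0
  div_B : ∀ z ∈ U, divg B z = 0
  div_J : ∀ z ∈ U, divg J z = 0
  hamiltonian : ∀ z ∈ U, cross3 (J z) (B z) = gradient p z

/-- A nondegenerate elliptic magnetic axis: a compact image of a periodic integral
curve of `B` on which `∇p = 0` and the Hessian of `p`, restricted to the plane
orthogonal to `B`, is positive or negative definite. -/
def IsNondegenerateEllipticAxis (U : Set R3) (B : R3 → R3) (p : R3 → ℝ)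
    (γ : Set R3) : Prop :=
  IsCompact γ ∧ γ ⊆ U ∧ IsPeriodicOrbit U B γ ∧
  (∀ z ∈ γ, gradient p z = 0) ∧
  ∀ z ∈ γ,
    (∀ u : R3, u ≠ 0 → ⟪u, B z⟫ = 0 → 0 < hess p z u u) ∨
    (∀ u : R3, u ≠ 0 → ⟪u, B z⟫ = 0 → hess p z u u < 0)

/-- The solid cylinder `D_r × ℝ = {(x,y,φ) : x² + y² < r²}` in `ℝ³`. -/
def Dset (r : ℝ) : Set R3 := {q | (q 0) ^ 2 + (q 1) ^ 2 < r ^ 2}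

/-- The slab `(ψ₁, ψ₂) × ℝ²` in `ℝ³`. -/
def Slab (ψ₁ ψ₂ : ℝ) : Set R3 := {q | q 0 ∈ Set.Ioo ψ₁ ψ₂}

section

open Set Filter Topology Metric
open scoped ContDiff NNReal

section Nemytskii

variable {K : Type*} [TopologicalSpace K] [CompactSpace K]

/-- Pointwise application of a continuous family of linear maps to a continuous map. -/
def pointwiseApplyCLM (K : Type*) [TopologicalSpace K] [CompactSpace K]
    (E F : Type*) [NormedAddCommGroup E] [NormedSpace ℝ E] [NormedAddCommGroup F]
    [NormedSpace ℝ F] : C(K, E →L[ℝ] F) →L[ℝ] C(K, E) →L[ℝ] C(K, F) :=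
  LinearMap.mkContinuous₂
    (LinearMap.mk₂ ℝ (fun (A : C(K, E →L[ℝ] F)) (h : C(K, E)) => (⟨fun t => A t (h t), by fun_prop⟩ : C(K, F)))
      (fun _ _ _ => by ext; simp) (fun _ _ _ => by ext; simp)
      (fun _ _ _ => by ext; simp) (fun _ _ _ => by ext; simp)) 1
    (fun A h => by
      rw [ContinuousMap.norm_le _ (by positivity)]
      intro t
      rw [one_mul]
      have h1 : ‖A t‖ ≤ ‖A‖ := A.norm_coe_le_norm t
      have h2 : ‖h t‖ ≤ ‖h‖ := h.norm_coe_le_norm t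
      exact ((A t).le_opNorm (h t)).trans (by gcongr))

@[simp] lemma pointwiseApplyCLM_apply {E F : Type*} [NormedAddCommGroup E] [NormedSpace ℝ E]
    [NormedAddCommGroup F] [NormedSpace ℝ F] (A : C(K, E →L[ℝ] F)) (h : C(K, E)) (t : K) :
    pointwiseApplyCLM K E F A h t = A t (h t) := rfl

/-- First-order Taylor estimate, uniform over a compact set of base points. -/
lemma eventually_norm_taylor_le {E F : Type*} [NormedAddCommGroup E] [NormedSpace ℝ E]
    [NormedAddCommGroup F] [NormedSpace ℝ F] {f : E → F} (hf : ContDiff ℝ 1 f) {S : Set E}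
    (hS : IsCompact S) {ε : ℝ} (hε : 0 < ε) :
    ∀ᶠ v in 𝓝 (0 : E), ∀ x ∈ S, ‖f (x + v) - f x - fderiv ℝ f x v‖ ≤ ε * ‖v‖ := by
  refine hS.eventually_forall_of_forall_eventually fun x₀ _ => ?_
  have h1 := (hf.contDiffAt (x := x₀)).hasStrictFDerivAt one_ne_zero
  have h2 := h1.isLittleO.def (half_pos hε)
  have hc : Continuous (fderiv ℝ f) := hf.continuous_fderiv one_ne_zero
  have h3 : ∀ᶠ x in 𝓝 x₀, ‖fderiv ℝ f x - fderiv ℝ f x₀‖ < ε / 2 := by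
    have := (hc.tendsto x₀) (Metric.ball_mem_nhds _ (half_pos hε))
    filter_upwards [this] with x hx
    simpa [dist_eq_norm] using hx
  have t1 : Tendsto (fun p : E × E => (p.2 + p.1, p.2)) (𝓝 ((0 : E), x₀)) (𝓝 (x₀, x₀)) := by
    have : Continuous (fun p : E × E => (p.2 + p.1, p.2)) := by fun_prop
    simpa using this.tendsto ((0 : E), x₀)
  have t2 : Tendsto (fun p : E × E => p.2) (𝓝 ((0 : E), x₀)) (𝓝 x₀) := continuous_snd.tendsto _
  filter_upwards [t1.eventually h2, t2.eventually h3] with p hp hp'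
  have e : f (p.2 + p.1) - f p.2 - fderiv ℝ f p.2 p.1
      = (f (p.2 + p.1) - f p.2 - fderiv ℝ f x₀ (p.2 + p.1 - p.2))
        - (fderiv ℝ f p.2 - fderiv ℝ f x₀) p.1 := by
    simp
  rw [e]
  refine (norm_sub_le _ _).trans ?_
  have h4 := (fderiv ℝ f p.2 - fderiv ℝ f x₀).le_opNorm p.1
  simp only [add_sub_cancel_left] at hp ⊢
  have h5 : ‖fderiv ℝ f p.2 - fderiv ℝ f x₀‖ * ‖p.1‖ ≤ ε / 2 * ‖p.1‖ := by gcongr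
  linarith

lemma hasFDerivAt_postcomp {E F : Type*} [NormedAddCommGroup E] [NormedSpace ℝ E]
    [NormedAddCommGroup F] [NormedSpace ℝ F] {f : E → F} (hf : ContDiff ℝ 1 f) (u : C(K, E)) :
    HasFDerivAt (fun u : C(K, E) => (⟨f, hf.continuous⟩ : C(E, F)).comp u)
      (pointwiseApplyCLM K E F
        ((⟨fderiv ℝ f, hf.continuous_fderiv one_ne_zero⟩ : C(E, E →L[ℝ] F)).comp u)) u := by
  rw [hasFDerivAt_iff_isLittleO_nhds_zero]
  refine Asymptotics.IsLittleO.of_bound fun ε hε => ?_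
  have h := eventually_norm_taylor_le hf (isCompact_range u.continuous) hε
  obtain ⟨δ, hδ, hb⟩ := Metric.eventually_nhds_iff.1 h
  filter_upwards [Metric.ball_mem_nhds (0 : C(K, E)) hδ] with v hv
  rw [ContinuousMap.norm_le _ (by positivity)]
  intro t
  have hvt : ‖v t‖ ≤ ‖v‖ := v.norm_coe_le_norm t
  have := hb (y := v t) (by
    rw [dist_zero_right]; exact hvt.trans_lt (by simpa using hv)) (u t) ⟨t, rfl⟩
  refine le_trans (le_of_eq ?_) (this.trans (by gcongr))
  simp

/-- Postcomposition by a `C^n` map is `C^n` on continuous maps from a compact space. -/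
theorem contDiff_postcomp {E : Type} [NormedAddCommGroup E] [NormedSpace ℝ E] (n : ℕ) :
    ∀ {F : Type} [NormedAddCommGroup F] [NormedSpace ℝ F] {f : E → F} (hf : ContDiff ℝ n f),
      ContDiff ℝ n (fun u : C(K, E) => (⟨f, hf.continuous⟩ : C(E, F)).comp u) := by
  induction n with
  | zero =>
    intro F _ _ f hf
    exact contDiff_zero.2 (ContinuousMap.continuous_postcomp _)
  | succ n ih =>
    intro F _ _ f hf
    have hf1 : ContDiff ℝ 1 f := hf.of_le (by simp)
    have hd : ContDiff ℝ n (fderiv ℝ f) := hf.fderiv_right (by simp)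
    push_cast
    rw [contDiff_succ_iff_fderiv]
    refine ⟨fun u => (hasFDerivAt_postcomp hf1 u).differentiableAt, by simp, ?_⟩
    have e : fderiv ℝ (fun u : C(K, E) => (⟨f, hf.continuous⟩ : C(E, F)).comp u)
        = fun u => pointwiseApplyCLM K E F
            ((⟨fderiv ℝ f, hd.continuous⟩ : C(E, E →L[ℝ] F)).comp u) :=
      funext fun u => (hasFDerivAt_postcomp hf1 u).fderiv
    rw [e]
    exact (pointwiseApplyCLM K E F).contDiff.comp (ih hd)

end Nemytskii

section Flow

variable {E : Type} [NormedAddCommGroup E]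

/-- The continuous extension to `ℝ` of a path on the unit interval. -/
def extendPath (u : C(Icc (0 : ℝ) 1, E)) (s : ℝ) : E := u (projIcc 0 1 zero_le_one s)

lemma continuous_extendPath (u : C(Icc (0 : ℝ) 1, E)) : Continuous (extendPath u) :=
  u.continuous.comp continuous_projIcc

lemma extendPath_of_mem (u : C(Icc (0 : ℝ) 1, E)) {s : ℝ} (hs : s ∈ Icc (0 : ℝ) 1) :
    extendPath u s = u ⟨s, hs⟩ := by
  rw [extendPath, projIcc_of_mem _ hs]

/-- The primitive vanishing at `0`, as a bounded operator on paths. -/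
def primitiveCLM (E : Type) [NormedAddCommGroup E] [NormedSpace ℝ E] :
    C(Icc (0 : ℝ) 1, E) →L[ℝ] C(Icc (0 : ℝ) 1, E) :=
  LinearMap.mkContinuous
    { toFun := fun u => ⟨fun s => ∫ r in (0 : ℝ)..s, extendPath u r,
        (intervalIntegral.continuous_primitive
          (fun _ _ => (continuous_extendPath u).intervalIntegrable _ _) 0).comp
          continuous_subtype_val⟩
      map_add' := fun u v => by
        ext s
        simp only [ContinuousMap.coe_mk, ContinuousMap.add_apply]
        rw [← intervalIntegral.integral_add ((continuous_extendPath u).intervalIntegrable _ _)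
          ((continuous_extendPath v).intervalIntegrable _ _)]
        rfl
      map_smul' := fun a u => by
        ext s
        simp only [ContinuousMap.coe_mk, ContinuousMap.smul_apply, RingHom.id_apply]
        rw [← intervalIntegral.integral_smul]
        rfl } 1
    (fun u => by
      rw [ContinuousMap.norm_le _ (by positivity), one_mul]
      intro s
      simp only [LinearMap.coe_mk, AddHom.coe_mk, ContinuousMap.coe_mk]
      refine (intervalIntegral.norm_integral_le_of_norm_le_const
        (C := ‖u‖) fun r _ => u.norm_coe_le_norm _).trans ?_
      rw [sub_zero, abs_of_nonneg s.2.1]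
      exact mul_le_of_le_one_right (norm_nonneg _) s.2.2)

lemma primitiveCLM_apply [NormedSpace ℝ E] (u : C(Icc (0 : ℝ) 1, E)) (s : Icc (0 : ℝ) 1) :
    primitiveCLM E u s = ∫ r in (0 : ℝ)..s, extendPath u r := rfl

/-- Constant paths, as a bounded operator. -/
def constPathCLM (E : Type) [NormedAddCommGroup E] [NormedSpace ℝ E] :
    E →L[ℝ] C(Icc (0 : ℝ) 1, E) :=
  LinearMap.mkContinuous
    { toFun := fun x => ContinuousMap.const _ x
      map_add' := fun _ _ => rfl
      map_smul' := fun _ _ => rfl } 1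
    (fun x => by
      rw [ContinuousMap.norm_le _ (by positivity), one_mul]
      intro s
      exact le_rfl)

lemma constPathCLM_apply [NormedSpace ℝ E] (x : E) (s : Icc (0 : ℝ) 1) : constPathCLM E x s = x := rfl

/-- A global flow of a Lipschitz smooth vector field is smooth near time zero. -/
lemma contDiffAt_flow_zero [NormedSpace ℝ E] [CompleteSpace E] {X : E → E} (n : ℕ)
    (hX : ContDiff ℝ (n + 1 : ℕ) X) {C : ℝ≥0} (hL : LipschitzWith C X) {φ : ℝ → E → E}
    (h0 : ∀ x, φ 0 x = x) (hφ : ∀ x t, HasDerivAt (fun t => φ t x) (X (φ t x)) t) (y : E) :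
    ContDiffAt ℝ (n + 1 : ℕ) (fun q : ℝ × E => φ q.1 q.2) (0, y) := by
  set N : C(Icc (0 : ℝ) 1, E) → C(Icc (0 : ℝ) 1, E) :=
    fun u => (⟨X, hX.continuous⟩ : C(E, E)).comp u with hN
  have hNs : ContDiff ℝ (n + 1 : ℕ) N := contDiff_postcomp (n + 1) hX
  set G : (ℝ × E) × C(Icc (0 : ℝ) 1, E) → C(Icc (0 : ℝ) 1, E) :=
    fun q => q.2 - constPathCLM E q.1.2 - q.1.1 • primitiveCLM E (N q.2) with hG
  have hGs : ContDiff ℝ (n + 1 : ℕ) G := by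
    have h1 : ContDiff ℝ (n + 1 : ℕ)
        (fun q : (ℝ × E) × C(Icc (0 : ℝ) 1, E) => primitiveCLM E (N q.2)) :=
      (primitiveCLM E).contDiff.comp (hNs.comp contDiff_snd)
    have h2 : ContDiff ℝ (n + 1 : ℕ)
        (fun q : (ℝ × E) × C(Icc (0 : ℝ) 1, E) => constPathCLM E q.1.2) :=
      (constPathCLM E).contDiff.comp (contDiff_snd.comp contDiff_fst)
    exact (contDiff_snd.sub h2).sub ((contDiff_fst.comp contDiff_fst).smul h1)
  set pt0 : (ℝ × E) × C(Icc (0 : ℝ) 1, E) := ((0, y), constPathCLM E y) with hpt0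
  have hG0 : G pt0 = 0 := by simp [hG, hpt0]
  have pn : ((n + 1 : ℕ) : ℕ∞ω) ≠ 0 := by exact_mod_cast Nat.succ_ne_zero n
  have hder : fderiv ℝ G pt0 ∘L .inr ℝ (ℝ × E) C(Icc (0 : ℝ) 1, E)
      = ContinuousLinearMap.id ℝ _ := by
    have h1 : HasFDerivAt G (fderiv ℝ G pt0) pt0 :=
      (hGs.differentiable (by exact_mod_cast pn) pt0).hasFDerivAt
    have h2 : HasFDerivAt (fun u : C(Icc (0 : ℝ) 1, E) => (((0 : ℝ), y), u))
        (.inr ℝ (ℝ × E) C(Icc (0 : ℝ) 1, E)) (constPathCLM E y) :=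
      hasFDerivAt_prodMk_right _ _
    have h3 := h1.comp (constPathCLM E y) h2
    have h4 : (G ∘ fun u : C(Icc (0 : ℝ) 1, E) => (((0 : ℝ), y), u))
        = fun u => u - constPathCLM E y := by
      funext u; simp [hG]
    rw [h4] at h3
    exact h3.unique ((hasFDerivAt_id _).sub_const _)
  have hinv : (fderiv ℝ G pt0 ∘L .inr ℝ (ℝ × E) C(Icc (0 : ℝ) 1, E)).IsInvertible := by
    rw [hder]; exact ⟨ContinuousLinearEquiv.refl ℝ _, rfl⟩
  have cdf := hGs.contDiffAt (x := pt0)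
  set u := cdf.implicitFunction pn hinv with hu
  have hus : ContDiffAt ℝ (n + 1 : ℕ) u (0, y) := cdf.contDiffAt_implicitFunction pn hinv
  have hue : ∀ᶠ q in 𝓝 ((0 : ℝ), y), G (q, u q) = 0 := by
    have := cdf.eventually_apply_implicitFunction pn hinv
    rwa [hG0] at this
  have hfin : ContDiffAt ℝ (n + 1 : ℕ) (fun q => u q ⟨1, by simp⟩) (0, y) :=
    ((ContinuousMap.evalCLM ℝ (M := E)
      (⟨1, by simp⟩ : Icc (0 : ℝ) 1)).contDiff (n := (n + 1 : ℕ))).contDiffAt.comp _ hus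
  refine hfin.congr_of_eventuallyEq ?_
  filter_upwards [hue] with q hq
  set a := q.1
  set x := q.2
  have hv : ∀ s ∈ Icc (0 : ℝ) 1, extendPath (u q) s
      = x + a • ∫ r in (0 : ℝ)..s, X (extendPath (u q) r) := by
    intro s hs
    have h := DFunLike.congr_fun hq ⟨s, hs⟩
    simp only [hG, ContinuousMap.sub_apply, ContinuousMap.smul_apply, constPathCLM_apply,
      primitiveCLM_apply, ContinuousMap.zero_apply] at h
    rw [extendPath_of_mem _ hs]
    have h' := sub_eq_zero.1 (sub_eq_zero.1 h ▸ sub_self _ : u q ⟨s, hs⟩ - x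
      - (a • ∫ r in (0 : ℝ)..s, extendPath (N (u q)) r) = 0)
    rw [sub_eq_iff_eq_add'] at h'
    exact h'
  have hcX : Continuous fun r => X (extendPath (u q) r) :=
    hX.continuous.comp (continuous_extendPath _)
  have hw : ∀ s, HasDerivAt (fun s => x + a • ∫ r in (0 : ℝ)..s, X (extendPath (u q) r))
      (a • X (extendPath (u q) s)) s := fun s =>
    ((hcX.integral_hasStrictDerivAt 0 s).hasDerivAt.const_smul a).const_add x
  have huniq := ODE_solution_unique (v := fun _ z => a • X z) (K := ‖a‖₊ * C) (a := 0) (b := 1)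
    (f := fun s => x + a • ∫ r in (0 : ℝ)..s, X (extendPath (u q) r))
    (g := fun s => φ (a * s) x)
    (fun _ => LipschitzWith.of_dist_le_mul fun z z' => by
      rw [dist_smul₀, NNReal.coe_mul, mul_assoc]
      exact mul_le_mul_of_nonneg_left (hL.dist_le_mul z z') (norm_nonneg a))
    (fun s _ => (hw s).continuousAt.continuousWithinAt)
    (fun s hs => by
      have := (hw s).hasDerivWithinAt (s := Ici s)
      rwa [hv s ⟨hs.1, hs.2.le⟩] at this)
    (fun s _ => by
      have := (hφ x (a * s)).scomp s ((hasDerivAt_id s).const_mul a)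
      exact this.continuousAt.continuousWithinAt)
    (fun s _ => by
      have := (hφ x (a * s)).scomp s ((hasDerivAt_id s).const_mul a)
      simpa using! this.hasDerivWithinAt)
    (by simp [h0])
  have h1 := huniq (show (1 : ℝ) ∈ Icc (0 : ℝ) 1 by simp)
  simp only [mul_one] at h1
  rw [← hv 1 (by simp), extendPath_of_mem _ (by simp : (1 : ℝ) ∈ Icc (0 : ℝ) 1)] at h1
  exact h1.symm

/-- A flow that is smooth near time zero is smooth. -/
lemma contDiff_of_contDiffAt_zero [NormedSpace ℝ E] {φ : ℝ → E → E} {n : ℕ}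
    (hadd : ∀ s t x, φ (s + t) x = φ s (φ t x))
    (hcont : ∀ x, Continuous fun t => φ t x)
    (hloc : ∀ y, ContDiffAt ℝ n (fun q : ℝ × E => φ q.1 q.2) (0, y)) :
    ContDiff ℝ n (fun q : ℝ × E => φ q.1 q.2) := by
  have hstep : ∀ x t t', (ContDiffAt ℝ n (fun q : ℝ × E => φ q.1 q.2) (t, x)) →
      (ContDiffAt ℝ n (fun q : ℝ × E => φ q.1 q.2) (t' - t, φ t x)) →
      ContDiffAt ℝ n (fun q : ℝ × E => φ q.1 q.2) (t', x) := by
    intro x t t' h1 h2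
    have e : (fun q : ℝ × E => φ q.1 q.2) = fun q : ℝ × E => φ (q.1 - t) (φ t q.2) := by
      funext q; rw [← hadd, sub_add_cancel]
    rw [e]
    have h3 : ContDiffAt ℝ n (fun q : ℝ × E => φ t q.2) (t', x) :=
      ContDiffAt.comp (g := fun q : ℝ × E => φ q.1 q.2) (f := fun q : ℝ × E => (t, q.2)) (t', x)
        h1 (by fun_prop)
    exact ContDiffAt.comp (g := fun q : ℝ × E => φ q.1 q.2)
      (f := fun q : ℝ × E => (q.1 - t, φ t q.2)) (t', x) h2 (by fun_prop)
  rw [contDiff_iff_contDiffAt]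
  rintro ⟨t, x⟩
  set S : Set ℝ := {t | ContDiffAt ℝ n (fun q : ℝ × E => φ q.1 q.2) (t, x)} with hS
  suffices S = univ by
    have : t ∈ S := this ▸ mem_univ t
    exact this
  have hev : ∀ a : ℝ, ∀ᶠ q : ℝ × ℝ in 𝓝 (a, a),
      ContDiffAt ℝ n (fun q : ℝ × E => φ q.1 q.2) (q.2 - q.1, φ q.1 x) := by
    intro a
    have h := (hloc (φ a x)).eventually (by simp)
    have hc : Continuous fun q : ℝ × ℝ => (q.2 - q.1, φ q.1 x) :=
      (continuous_snd.sub continuous_fst).prodMk ((hcont x).comp continuous_fst)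
    have := hc.tendsto (a, a)
    simp only [sub_self] at this
    exact this.eventually h
  have hne : S.Nonempty := ⟨0, hloc x⟩
  have hball : ∀ a : ℝ, ∃ u ∈ 𝓝 a, ∀ t ∈ u, ∀ t' ∈ u, t ∈ S → t' ∈ S := by
    intro a
    obtain ⟨u, hu, v, hv, h⟩ := mem_nhds_prod_iff.1 (hev a)
    exact ⟨u ∩ v, inter_mem hu hv, fun t ht t' ht' hts =>
      hstep x t t' hts (h (mk_mem_prod ht.1 ht'.2))⟩
  have hclopen : IsClopen S := by
    constructor
    · rw [← isOpen_compl_iff, isOpen_iff_mem_nhds]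
      intro a ha
      obtain ⟨u, hu, h⟩ := hball a
      exact mem_of_superset hu fun t ht hts => ha (h t ht a (mem_of_mem_nhds hu) hts)
    · rw [isOpen_iff_mem_nhds]
      intro a ha
      obtain ⟨u, hu, h⟩ := hball a
      exact mem_of_superset hu fun t ht => h a (mem_of_mem_nhds hu) t ht ha
  exact hclopen.eq_univ hne

/-- A globally Lipschitz, bounded vector field has a global flow. -/
lemma exists_flow [NormedSpace ℝ E] [CompleteSpace E] {X : E → E} {C L : ℝ≥0}
    (hL : LipschitzWith C X) (hb : ∀ x, ‖X x‖ ≤ L) (x : E) :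
    ∃ γ : ℝ → E, γ 0 = x ∧ ∀ t, HasDerivAt γ (X (γ t)) t := by
  have hloc : ∀ T : ℝ, ∃ α : ℝ → E, α 0 = x ∧ (0 < T →
      ∀ t ∈ Ioo (-T) T, HasDerivAt α (X (α t)) t) := by
    intro T
    rcases le_or_gt T 0 with hT | hT
    · exact ⟨fun _ => x, rfl, fun h => absurd hT (not_le.2 h)⟩
    have hp : IsPicardLindelof (fun _ => X) (⟨0, by constructor <;> linarith⟩ : Icc (-T) T) x
        (L * T.toNNReal) 0 L C :=
      IsPicardLindelof.of_time_independent (fun z _ => hb z) hL.lipschitzOnWith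
        (by simp [hT.le])
    obtain ⟨α, h0, hα⟩ := hp.exists_eq_forall_mem_Icc_hasDerivWithinAt₀
    exact ⟨α, h0, fun _ t ht => (hα t ⟨ht.1.le, ht.2.le⟩).hasDerivAt (Icc_mem_nhds ht.1 ht.2)⟩
  choose α h0 hα using hloc
  have hagree : ∀ T T' : ℝ, 0 < T → T ≤ T' → EqOn (α T) (α T') (Ioo (-T) T) := by
    intro T T' hT hTT'
    exact ODE_solution_unique_of_mem_Ioo (v := fun _ => X) (s := fun _ => univ) (K := C) (t₀ := 0)
      (fun _ _ => hL.lipschitzOnWith) (by constructor <;> linarith)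
      (fun t ht => ⟨hα T hT t ht, mem_univ _⟩)
      (fun t ht => ⟨hα T' (hT.trans_le hTT') t
        ⟨by linarith [ht.1], by linarith [ht.2]⟩, mem_univ _⟩) (by rw [h0, h0])
  refine ⟨fun t => α (|t| + 1) t, by simp [h0], fun t => ?_⟩
  have hT : 0 < |t| + 2 := by positivity
  have ht : t ∈ Ioo (-(|t| + 2)) (|t| + 2) :=
    ⟨by linarith [neg_abs_le t], by linarith [le_abs_self t]⟩
  have hmem : ∀ s : ℝ, s ∈ Ioo (-(|s| + 1)) (|s| + 1) := fun s =>
    ⟨by linarith [neg_abs_le s], by linarith [le_abs_self s]⟩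
  have hev : (fun s => α (|s| + 1) s) =ᶠ[𝓝 t] α (|t| + 2) := by
    have : ∀ᶠ s : ℝ in 𝓝 t, |s| < |t| + 1 :=
      continuous_abs.continuousAt.eventually_lt continuousAt_const (by simp)
    filter_upwards [this] with s hs
    exact hagree _ _ (by positivity) (by linarith) (hmem s)
  have := hα (|t| + 2) hT t ht
  rw [← hev.eq_of_nhds] at this
  exact this.congr_of_eventuallyEq hev

/-- The global smooth flow of a compactly supported smooth vector field. -/
theorem exists_smooth_flow [NormedSpace ℝ E] [FiniteDimensional ℝ E] {X : E → E}
    (hX : ContDiff ℝ ∞ X) (hc : HasCompactSupport X) :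
    ∃ φ : ℝ → E → E, (∀ x, φ 0 x = x) ∧ (∀ s t x, φ (s + t) x = φ s (φ t x)) ∧
      (∀ x t, HasDerivAt (fun t => φ t x) (X (φ t x)) t) ∧
      ContDiff ℝ ∞ (fun q : ℝ × E => φ q.1 q.2) := by
  have : CompleteSpace E := FiniteDimensional.complete ℝ E
  obtain ⟨C, hL⟩ := ContDiff.lipschitzWith_of_hasCompactSupport hc hX (by simp)
  obtain ⟨L, hb⟩ := hc.exists_bound_of_continuous hX.continuous
  choose φ h0 hφ using exists_flow hL (L := L.toNNReal)
    fun x => (hb x).trans (Real.le_coe_toNNReal L)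
  have huniq : ∀ γ γ' : ℝ → E, (∀ t, HasDerivAt γ (X (γ t)) t) →
      (∀ t, HasDerivAt γ' (X (γ' t)) t) → γ 0 = γ' 0 → γ = γ' := fun γ γ' h h' e =>
    ODE_solution_unique_univ (v := fun _ => X) (s := fun _ => univ) (K := C) (t₀ := 0)
      (fun _ => hL.lipschitzOnWith) (fun t => ⟨h t, mem_univ _⟩) (fun t => ⟨h' t, mem_univ _⟩) e
  have hadd : ∀ s t x, φ x (s + t) = φ (φ x t) s := by
    intro s t x
    have := huniq (fun s => φ x (s + t)) (φ (φ x t))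
      (fun s => HasDerivAt.comp_add_const s t (hφ x (s + t))) (hφ _) (by simp [h0])
    exact congrFun this s
  refine ⟨fun t x => φ x t, h0, hadd, hφ, ?_⟩
  rw [contDiff_infty]
  intro n
  have : ContDiff ℝ (n + 1 : ℕ) (fun q : ℝ × E => φ q.2 q.1) :=
    contDiff_of_contDiffAt_zero (φ := fun t x => φ x t) hadd
      (fun x => continuous_iff_continuousAt.2 fun t => (hφ x t).continuousAt)
      (contDiffAt_flow_zero n (hX.of_le (by exact_mod_cast le_top)) hL h0 hφ)
  exact this.of_le (by exact_mod_cast Nat.le_succ n)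

end Flow

section CommutingFlows

variable {E : Type} [NormedAddCommGroup E] [NormedSpace ℝ E]

/-- The spatial differential of a smooth flow solves the variational equation. -/
lemma hasDerivAt_fderiv_flow {Y : E → E} (hY : ContDiff ℝ ∞ Y) {ψ : ℝ → E → E}
    (hψ : ∀ x t, HasDerivAt (fun t => ψ t x) (Y (ψ t x)) t)
    (hψs : ContDiff ℝ ∞ (fun q : ℝ × E => ψ q.1 q.2)) (z v : E) (t : ℝ) :
    HasDerivAt (fun t => fderiv ℝ (ψ t) z v) (fderiv ℝ Y (ψ t z) (fderiv ℝ (ψ t) z v)) t := by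
  set h : ℝ × E → E := fun q => ψ q.1 q.2 with hh
  have hd : ∀ q, HasFDerivAt h (fderiv ℝ h q) q := fun q =>
    (hψs.differentiable (by simp) q).hasFDerivAt
  have hs1 : ContDiff ℝ ∞ (fderiv ℝ h) := hψs.fderiv_right (by simp)
  have hd2 : ∀ q, HasFDerivAt (fderiv ℝ h) (fderiv ℝ (fderiv ℝ h) q) q := fun q =>
    (hs1.differentiable (by simp) q).hasFDerivAt
  have hx : ∀ t z, HasFDerivAt (ψ t) ((fderiv ℝ h (t, z)).comp (.inr ℝ ℝ E)) z := fun t z =>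
    (hd (t, z)).comp z (hasFDerivAt_prodMk_right t z)
  have ht : ∀ t z, fderiv ℝ h (t, z) (1, 0) = Y (ψ t z) := fun t z => by
    have h1 : HasDerivAt (fun t => h (t, z)) (fderiv ℝ h (t, z) (1, 0)) t :=
      (hd (t, z)).comp_hasDerivAt (f := fun t : ℝ => (t, z)) t ((hasDerivAt_id t).prodMk (hasDerivAt_const t z))
    exact h1.unique (hψ z t)
  have e : ∀ t, fderiv ℝ (ψ t) z v = fderiv ℝ h (t, z) (0, v) := fun t => by
    rw [(hx t z).fderiv]; simp
  simp_rw [e]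
  have h1 : HasDerivAt (fun t => fderiv ℝ h (t, z)) (fderiv ℝ (fderiv ℝ h) (t, z) (1, 0)) t :=
    (hd2 (t, z)).comp_hasDerivAt (f := fun t : ℝ => (t, z)) t ((hasDerivAt_id t).prodMk (hasDerivAt_const t z))
  have h2 := h1.clm_apply (hasDerivAt_const t ((0 : ℝ), v))
  simp only [map_zero, add_zero] at h2
  have hsymm : IsSymmSndFDerivAt ℝ h (t, z) :=
    (hψs.contDiffAt (x := (t, z))).isSymmSndFDerivAt (by simp only [minSmoothness_of_isRCLikeNormedField]; exact WithTop.coe_le_coe.2 (le_top : (2 : ℕ∞) ≤ ⊤))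
  rw [hsymm.eq] at h2
  have h3 : HasFDerivAt (fun x => fderiv ℝ h (t, x) (1, 0))
      (((fderiv ℝ (fderiv ℝ h) (t, z)).comp (.inr ℝ ℝ E)).flip (1, 0)) z := by
    have := ((hd2 (t, z)).comp z (hasFDerivAt_prodMk_right t z)).clm_apply
      (hasFDerivAt_const ((1 : ℝ), (0 : E)) z)
    simpa using! this
  have h4 : HasFDerivAt (fun x => fderiv ℝ h (t, x) (1, 0))
      ((fderiv ℝ Y (ψ t z)).comp ((fderiv ℝ h (t, z)).comp (.inr ℝ ℝ E))) z := by
    simp_rw [ht]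
    exact ((hY.differentiable (by simp) _).hasFDerivAt).comp z (hx t z)
  have h5 := DFunLike.congr_fun (h3.unique h4) v
  simp only [ContinuousLinearMap.flip_apply, ContinuousLinearMap.comp_apply,
    ContinuousLinearMap.inr_apply] at h5
  rwa [h5] at h2

/-- A smooth vector field commuting with `Y` is invariant under the flow of `Y`. -/
lemma fderiv_flow_apply_eq {X Y : E → E} (hX : ContDiff ℝ ∞ X) (hY : ContDiff ℝ ∞ Y)
    (hYc : HasCompactSupport Y) (hcomm : ∀ z, fderiv ℝ X z (Y z) = fderiv ℝ Y z (X z))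
    {ψ : ℝ → E → E} (h0 : ∀ x, ψ 0 x = x)
    (hψ : ∀ x t, HasDerivAt (fun t => ψ t x) (Y (ψ t x)) t)
    (hψs : ContDiff ℝ ∞ (fun q : ℝ × E => ψ q.1 q.2)) (z : E) (t : ℝ) :
    fderiv ℝ (ψ t) z (X z) = X (ψ t z) := by
  obtain ⟨C, hC⟩ := (hYc.fderiv ℝ).exists_bound_of_continuous (hY.continuous_fderiv (by simp))
  have h := ODE_solution_unique_univ (v := fun t w => fderiv ℝ Y (ψ t z) w)
    (s := fun _ => univ) (K := C.toNNReal) (t₀ := 0)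
    (f := fun t => fderiv ℝ (ψ t) z (X z)) (g := fun t => X (ψ t z))
    (fun t => ((fderiv ℝ Y (ψ t z)).lipschitz.weaken (by
      rw [← NNReal.coe_le_coe]
      exact (hC _).trans (Real.le_coe_toNNReal C))).lipschitzOnWith)
    (fun t => ⟨hasDerivAt_fderiv_flow hY hψ hψs z (X z) t, mem_univ _⟩)
    (fun t => ⟨by
      rw [← hcomm]
      exact ((hX.differentiable (by simp) _).hasFDerivAt).comp_hasDerivAt t (hψ z t),
      mem_univ _⟩)
    (by
      have : ψ 0 = id := funext h0
      simp [this])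
  exact congrFun h t

/-- Two commuting compactly supported smooth vector fields generate a smooth action of the
plane. -/
theorem exists_smooth_plane_action [FiniteDimensional ℝ E] {X Y : E → E}
    (hX : ContDiff ℝ ∞ X) (hY : ContDiff ℝ ∞ Y) (hXc : HasCompactSupport X)
    (hYc : HasCompactSupport Y) (hcomm : ∀ z, fderiv ℝ X z (Y z) = fderiv ℝ Y z (X z)) :
    ∃ A : ℝ × ℝ → E → E, (∀ z, A 0 z = z) ∧ (∀ v w z, A (v + w) z = A v (A w z)) ∧
      ContDiff ℝ ∞ (fun q : (ℝ × ℝ) × E => A q.1 q.2) ∧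
      ∀ w z, HasFDerivAt (fun w => A w z)
        ((ContinuousLinearMap.fst ℝ ℝ ℝ).smulRight (X (A w z)) +
          (ContinuousLinearMap.snd ℝ ℝ ℝ).smulRight (Y (A w z))) w := by
  obtain ⟨φ, φ0, φadd, φd, φs⟩ := exists_smooth_flow hX hXc
  obtain ⟨ψ, ψ0, ψadd, ψd, ψs⟩ := exists_smooth_flow hY hYc
  obtain ⟨C, hL⟩ := ContDiff.lipschitzWith_of_hasCompactSupport hXc hX (by simp)
  have hψt : ∀ t, ContDiff ℝ ∞ (ψ t) := fun t =>
    ψs.comp (f := fun z => (t, z)) (contDiff_const.prodMk contDiff_id)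
  have hsw : ∀ s t z, ψ t (φ s z) = φ s (ψ t z) := by
    intro s t z
    have := ODE_solution_unique_univ (v := fun _ => X) (s := fun _ => univ) (K := C) (t₀ := 0)
      (f := fun s => ψ t (φ s z)) (g := fun s => φ s (ψ t z))
      (fun _ => hL.lipschitzOnWith)
      (fun s => ⟨by
        have h1 := ((hψt t).differentiable (by simp) (φ s z)).hasFDerivAt.comp_hasDerivAt s
          (φd z s)
        rwa [fderiv_flow_apply_eq hX hY hYc hcomm ψ0 ψd ψs] at h1, mem_univ _⟩)
      (fun s => ⟨φd _ s, mem_univ _⟩) (by simp [φ0])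
    exact congrFun this s
  have hAs : ContDiff ℝ ∞ (fun q : (ℝ × ℝ) × E => φ q.1.1 (ψ q.1.2 q.2)) :=
    φs.comp (f := fun q : (ℝ × ℝ) × E => (q.1.1, ψ q.1.2 q.2))
      ((contDiff_fst.comp contDiff_fst).prodMk
        (ψs.comp (f := fun q : (ℝ × ℝ) × E => (q.1.2, q.2)) (by fun_prop)))
  refine ⟨fun w z => φ w.1 (ψ w.2 z), by simp [φ0, ψ0], ?_, hAs, ?_⟩
  · intro v w z
    simp only [Prod.fst_add, Prod.snd_add, φadd, ψadd, hsw]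
  · intro w z
    have hc : ContDiff ℝ ∞ (fun w : ℝ × ℝ => φ w.1 (ψ w.2 z)) :=
      hAs.comp (f := fun w : ℝ × ℝ => (w, z)) (by fun_prop)
    have hd := (hc.differentiable (by simp) w).hasFDerivAt
    set D := fderiv ℝ (fun w : ℝ × ℝ => φ w.1 (ψ w.2 z)) w with hD
    have h1 : D (1, 0) = X (φ w.1 (ψ w.2 z)) := by
      have h : HasDerivAt (fun s => φ s (ψ w.2 z)) (D (1, 0)) w.1 :=
        hd.comp_hasDerivAt (f := fun s : ℝ => (s, w.2)) w.1
          ((hasDerivAt_id w.1).prodMk (hasDerivAt_const w.1 w.2))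
      exact h.unique (φd _ _)
    have h2 : D (0, 1) = Y (φ w.1 (ψ w.2 z)) := by
      have h : HasDerivAt (fun t => φ w.1 (ψ t z)) (D (0, 1)) w.2 :=
        hd.comp_hasDerivAt (f := fun t : ℝ => (w.1, t)) w.2
          ((hasDerivAt_const w.2 w.1).prodMk (hasDerivAt_id w.2))
      simp_rw [← hsw] at h
      have := h.unique (ψd (φ w.1 z) w.2)
      rw [this, hsw]
    have e : (ContinuousLinearMap.fst ℝ ℝ ℝ).smulRight (X (φ w.1 (ψ w.2 z))) +
        (ContinuousLinearMap.snd ℝ ℝ ℝ).smulRight (Y (φ w.1 (ψ w.2 z))) = D := by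
      rw [← h1, ← h2]
      refine ContinuousLinearMap.ext fun v => ?_
      have hv : v = v.1 • ((1 : ℝ), (0 : ℝ)) + v.2 • ((0 : ℝ), (1 : ℝ)) := by ext <;> simp
      conv_rhs => rw [hv]
      simp only [map_add, map_smul]
      rfl
    show HasFDerivAt _ ((ContinuousLinearMap.fst ℝ ℝ ℝ).smulRight (X (φ w.1 (ψ w.2 z))) +
        (ContinuousLinearMap.snd ℝ ℝ ℝ).smulRight (Y (φ w.1 (ψ w.2 z)))) w
    rw [e]
    exact hd

end CommutingFlows

section VectorCalculus

/-- The cross product as a bounded bilinear map. -/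
def crossCLM : R3 →L[ℝ] R3 →L[ℝ] R3 :=
  LinearMap.toContinuousLinearMap
    (LinearMap.toContinuousLinearMap.toLinearMap.comp
      (LinearMap.mk₂ ℝ cross3
        (fun u v w => by ext i; fin_cases i <;> simp [cross3, pt] <;> ring)
        (fun a u v => by ext i; fin_cases i <;> simp [cross3, pt] <;> ring)
        (fun u v w => by ext i; fin_cases i <;> simp [cross3, pt] <;> ring)
        (fun a u v => by ext i; fin_cases i <;> simp [cross3, pt] <;> ring)))

@[simp] lemma crossCLM_apply (u v : R3) : crossCLM u v = cross3 u v := rfl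

/-- The Riesz identification of the dual of `ℝ³` with `ℝ³`. -/
def rieszCLM : (R3 →L[ℝ] ℝ) →L[ℝ] R3 :=
  ∑ i : Fin 3, (ContinuousLinearMap.apply ℝ ℝ (e3 i)).smulRight (e3 i)

lemma r3_eq_sum (v : R3) : v = v 0 • e3 0 + v 1 • e3 1 + v 2 • e3 2 := by
  ext i; fin_cases i <;> simp [e3]

lemma r3_ext {u v : R3} (h0 : u 0 = v 0) (h1 : u 1 = v 1) (h2 : u 2 = v 2) : u = v := by
  ext i; fin_cases i <;> assumption

lemma cross3_zero (u v : R3) : cross3 u v 0 = u 1 * v 2 - u 2 * v 1 := rfl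
lemma cross3_one (u v : R3) : cross3 u v 1 = u 2 * v 0 - u 0 * v 2 := rfl
lemma cross3_two (u v : R3) : cross3 u v 2 = u 0 * v 1 - u 1 * v 0 := rfl

@[simp] lemma pt_zero (x y z : ℝ) : pt x y z 0 = x := rfl
@[simp] lemma pt_one (x y z : ℝ) : pt x y z 1 = y := rfl
@[simp] lemma pt_two (x y z : ℝ) : pt x y z 2 = z := rfl

lemma inner_r3 (u v : R3) : ⟪u, v⟫ = u 0 * v 0 + u 1 * v 1 + u 2 * v 2 := by
  simp [PiLp.inner_apply, Fin.sum_univ_three, mul_comm]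

lemma norm_sq_r3 (u : R3) : ‖u‖ ^ 2 = u 0 ^ 2 + u 1 ^ 2 + u 2 ^ 2 := by
  rw [← real_inner_self_eq_norm_sq, inner_r3]; ring

lemma clm_r3_apply (L : R3 →L[ℝ] R3) (v : R3) (i : Fin 3) :
    L v i = L (e3 0) i * v 0 + L (e3 1) i * v 1 + L (e3 2) i * v 2 := by
  conv_lhs => rw [r3_eq_sum v]
  simp [mul_comm]

lemma gradient_apply (p : R3 → ℝ) (z : R3) (i : Fin 3) :
    gradient p z i = fderiv ℝ p z (e3 i) := by
  have h : ⟪gradient p z, e3 i⟫ = fderiv ℝ p z (e3 i) := by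
    simp [gradient]
  rw [← h, inner_r3]
  fin_cases i <;> simp [e3]

lemma gradient_eq_riesz (p : R3 → ℝ) (z : R3) : gradient p z = rieszCLM (fderiv ℝ p z) := by
  ext i
  rw [gradient_apply]
  fin_cases i <;> simp [rieszCLM, Fin.sum_univ_three, e3]

lemma inner_gradient (p : R3 → ℝ) (z v : R3) : ⟪gradient p z, v⟫ = fderiv ℝ p z v := by
  simp [gradient]

lemma trace_r3 (L : R3 →L[ℝ] R3) :
    LinearMap.trace ℝ R3 L.toLinearMap = L (e3 0) 0 + L (e3 1) 1 + L (e3 2) 2 := by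
  rw [LinearMap.trace_eq_matrix_trace ℝ (EuclideanSpace.basisFun (Fin 3) ℝ).toBasis]
  simp [Matrix.trace, Fin.sum_univ_three, LinearMap.toMatrix_apply, e3]

lemma det_r3 (L : R3 →L[ℝ] R3) :
    LinearMap.det L.toLinearMap = ⟪L (e3 0), cross3 (L (e3 1)) (L (e3 2))⟫ := by
  rw [← LinearMap.det_toMatrix (EuclideanSpace.basisFun (Fin 3) ℝ).toBasis, Matrix.det_fin_three,
    inner_r3]
  simp [LinearMap.toMatrix_apply, e3, cross3, pt]
  ring

lemma contDiffOn_gradient {U : Set R3} (hU : IsOpen U) {p : R3 → ℝ} (hp : ContDiffOn ℝ ∞ p U) :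
    ContDiffOn ℝ ∞ (gradient p) U := by
  have h := (hp.fderiv_of_isOpen (m := ∞) hU (by simp))
  have := rieszCLM.contDiff.comp_contDiffOn (s := U) h
  exact this.congr fun z _ => gradient_eq_riesz p z

lemma contDiffOn_cross {U : Set R3} {u v : R3 → R3} (hu : ContDiffOn ℝ ∞ u U)
    (hv : ContDiffOn ℝ ∞ v U) : ContDiffOn ℝ ∞ (fun z => cross3 (u z) (v z)) U :=
  (crossCLM.contDiff.comp_contDiffOn hu).clm_apply hv

/-- The field `B / |B|²`. -/
def fieldX (B : R3 → R3) (z : R3) : R3 := (‖B z‖ ^ 2)⁻¹ • B z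

/-- The field `B × ∇p / |B|²`. -/
def fieldY (B : R3 → R3) (p : R3 → ℝ) (z : R3) : R3 :=
  (‖B z‖ ^ 2)⁻¹ • cross3 (B z) (gradient p z)

variable {U : Set R3} {B : R3 → R3} {p : R3 → ℝ}

lemma contDiffOn_fieldX (hB : ContDiffOn ℝ ∞ B U) (hBne : ∀ z ∈ U, B z ≠ 0) :
    ContDiffOn ℝ ∞ (fieldX B) U :=
  ((hB.norm_sq ℝ).inv fun z hz => by simpa using hBne z hz).smul hB

lemma contDiffOn_fieldY (hU : IsOpen U) (hB : ContDiffOn ℝ ∞ B U) (hp : ContDiffOn ℝ ∞ p U)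
    (hBne : ∀ z ∈ U, B z ≠ 0) : ContDiffOn ℝ ∞ (fieldY B p) U :=
  ((hB.norm_sq ℝ).inv fun z hz => by simpa using hBne z hz).smul
    (contDiffOn_cross hB (contDiffOn_gradient hU hp))

lemma inner_gradient_field (hMHS : ∀ z ∈ U, cross3 (curl B z) (B z) = gradient p z) {z : R3}
    (hz : z ∈ U) : ⟪gradient p z, B z⟫ = 0 := by
  rw [← hMHS z hz, inner_r3]; simp [cross3, pt]; ring

lemma fderiv_fieldX (hMHS : ∀ z ∈ U, cross3 (curl B z) (B z) = gradient p z) {z : R3}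
    (hz : z ∈ U) : fderiv ℝ p z (fieldX B z) = 0 := by
  rw [← inner_gradient, fieldX, inner_smul_right, inner_gradient_field hMHS hz, mul_zero]

lemma fderiv_fieldY (z : R3) : fderiv ℝ p z (fieldY B p z) = 0 := by
  rw [← inner_gradient, fieldY, inner_smul_right, inner_r3]; simp [cross3, pt]; right; ring

lemma cross_fieldX_fieldY (hMHS : ∀ z ∈ U, cross3 (curl B z) (B z) = gradient p z) {z : R3}
    (hz : z ∈ U) (hBne : B z ≠ 0) :
    cross3 (fieldX B z) (fieldY B p z) = -(‖B z‖ ^ 2)⁻¹ • gradient p z := by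
  have h := inner_gradient_field hMHS hz
  have hn : ‖B z‖ ^ 2 ≠ 0 := by simpa using hBne
  have hr := norm_sq_r3 (B z)
  rw [inner_r3] at h
  have e : cross3 (fieldX B z) (fieldY B p z) =
      ((‖B z‖ ^ 2)⁻¹ * (‖B z‖ ^ 2)⁻¹) • cross3 (B z) (cross3 (B z) (gradient p z)) := by
    rw [fieldX, fieldY, ← crossCLM_apply, map_smul, map_smul, smul_apply,
      smul_smul, crossCLM_apply]
  have e2 : cross3 (B z) (cross3 (B z) (gradient p z)) = -(‖B z‖ ^ 2) • gradient p z := by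
    rw [hr]
    apply r3_ext <;> simp only [cross3_zero, cross3_one, cross3_two, PiLp.smul_apply, smul_eq_mul]
    · linear_combination (B z 0) * h
    · linear_combination (B z 1) * h
    · linear_combination (B z 2) * h
  rw [e, e2, smul_smul]
  congr 1
  field_simp

/-- The algebraic identity behind the commutation of `B / |B|²` and `B × ∇p / |B|²`. -/
lemma commutation_identity {L H : R3 →L[ℝ] R3} {b g : R3}
    (ht : L (e3 0) 0 + L (e3 1) 1 + L (e3 2) 2 = 0)
    (hg : cross3 (pt (L (e3 1) 2 - L (e3 2) 1) (L (e3 2) 0 - L (e3 0) 2)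
      (L (e3 0) 1 - L (e3 1) 0)) b = g)
    (hH : ∀ v, ⟪H b, v⟫ = -⟪g, L v⟫) :
    ‖b‖ ^ 2 • (L (cross3 b g) - (cross3 (L b) g + cross3 b (H b)))
      - (2 * ⟪b, L (cross3 b g)⟫) • b + (2 * ⟪b, L b⟫) • cross3 b g = 0 := by
  have h0 := hH (e3 0)
  have h1 := hH (e3 1)
  have h2 := hH (e3 2)
  have c0 : ∀ v : R3, v 0 * e3 0 0 + v 1 * e3 0 1 + v 2 * e3 0 2 = v 0 := by simp [e3]
  have c1 : ∀ v : R3, v 0 * e3 1 0 + v 1 * e3 1 1 + v 2 * e3 1 2 = v 1 := by simp [e3]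
  have c2 : ∀ v : R3, v 0 * e3 2 0 + v 1 * e3 2 1 + v 2 * e3 2 2 = v 2 := by simp [e3]
  rw [inner_r3, inner_r3, c0] at h0
  rw [inner_r3, inner_r3, c1] at h1
  rw [inner_r3, inner_r3, c2] at h2
  have ht' : L (e3 2) 2 = - L (e3 0) 0 - L (e3 1) 1 := by linarith
  have eb := clm_r3_apply L b
  have ew := clm_r3_apply L (cross3 b g)
  have g0 := congrArg (fun v : R3 => v 0) hg
  have g1 := congrArg (fun v : R3 => v 1) hg
  have g2 := congrArg (fun v : R3 => v 2) hg
  simp only [cross3_zero, cross3_one, cross3_two, pt_zero, pt_one, pt_two] at g0 g1 g2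
  apply r3_ext <;>
    simp only [PiLp.sub_apply, PiLp.add_apply, PiLp.smul_apply, smul_eq_mul, PiLp.zero_apply,
      inner_r3, eb, ew, norm_sq_r3, cross3_zero, cross3_one, cross3_two, h0, h1, h2, ht',
      ← g0, ← g1, ← g2] <;> ring

theorem fderiv_fieldX_fieldY (hU : IsOpen U) (hB : ContDiffOn ℝ ∞ B U)
    (hp : ContDiffOn ℝ ∞ p U) (hBne : ∀ z ∈ U, B z ≠ 0) (hdiv : ∀ z ∈ U, divg B z = 0)
    (hMHS : ∀ z ∈ U, cross3 (curl B z) (B z) = gradient p z) {z : R3} (hz : z ∈ U) :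
    fderiv ℝ (fieldX B) z (fieldY B p z) = fderiv ℝ (fieldY B p) z (fieldX B z) := by
  have hUz := hU.mem_nhds hz
  have dB : HasFDerivAt B (fderiv ℝ B z) z :=
    ((hB.contDiffAt hUz).differentiableAt (by simp)).hasFDerivAt
  have dG : HasFDerivAt (gradient p) (fderiv ℝ (gradient p) z) z :=
    (((contDiffOn_gradient hU hp).contDiffAt hUz).differentiableAt (by simp)).hasFDerivAt
  set L := fderiv ℝ B z
  set H := fderiv ℝ (gradient p) z
  have dr : HasFDerivAt (fun z => ‖B z‖ ^ 2) _ z := dB.norm_sq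
  have hn : ‖B z‖ ^ 2 ≠ 0 := by simpa using hBne z hz
  have dri := (hasDerivAt_inv hn).comp_hasFDerivAt z dr
  have dX : HasFDerivAt (fieldX B) _ z := dri.smul dB
  have dW : HasFDerivAt (fun z => cross3 (B z) (gradient p z)) _ z :=
    (crossCLM.hasFDerivAt.comp (f := B) z dB).clm_apply dG
  have dY : HasFDerivAt (fieldY B p) _ z := dri.smul dW
  have hsymm : ∀ u v, ⟪H u, v⟫ = ⟪H v, u⟫ := by
    have hs : IsSymmSndFDerivAt ℝ p z := (hp.contDiffAt hUz).isSymmSndFDerivAt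
      (by simp only [minSmoothness_of_isRCLikeNormedField]
          exact WithTop.coe_le_coe.2 (le_top : (2 : ℕ∞) ≤ ⊤))
    have dd : HasFDerivAt (fderiv ℝ p) (fderiv ℝ (fderiv ℝ p) z) z :=
      (((hp.contDiffAt hUz).fderiv_right (m := ∞) (by simp)).differentiableAt (by simp)).hasFDerivAt
    have key : ∀ u v, ⟪H u, v⟫ = fderiv ℝ (fderiv ℝ p) z u v := by
      intro u v
      have h1 : HasFDerivAt (fun z => ⟪gradient p z, v⟫) _ z :=
        dG.inner ℝ (hasFDerivAt_const v z)
      have h2 : HasFDerivAt (fun z => ⟪gradient p z, v⟫)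
          ((ContinuousLinearMap.apply ℝ ℝ v).comp (fderiv ℝ (fderiv ℝ p) z)) z := by
        simp_rw [inner_gradient]
        exact (ContinuousLinearMap.apply ℝ ℝ v).hasFDerivAt.comp z dd
      have := DFunLike.congr_fun (h1.unique h2) u
      simpa using this
    intro u v
    rw [key, key, hs.eq]
  have hH : ∀ v, ⟪H (B z), v⟫ = -⟪gradient p z, L v⟫ := by
    intro v
    have h1 : HasFDerivAt (fun z => ⟪gradient p z, B z⟫) _ z := dG.inner ℝ dB
    have h2 : HasFDerivAt (fun z => ⟪gradient p z, B z⟫) (0 : R3 →L[ℝ] ℝ) z :=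
      (hasFDerivAt_const (0 : ℝ) z).congr_of_eventuallyEq (by
        filter_upwards [hUz] with y hy using inner_gradient_field hMHS hy)
    have := DFunLike.congr_fun (h1.unique h2) v
    simp at this
    rw [hsymm, inner_gradient]
    linarith
  have ht := hdiv z hz
  rw [divg, trace_r3] at ht
  have key := commutation_identity ht (hMHS z hz) hH
  rw [dX.fderiv, dY.fderiv]
  set b := B z
  set g := gradient p z
  have e1 : fieldY B p z = (‖b‖ ^ 2)⁻¹ • cross3 b g := rfl
  have e2 : fieldX B z = (‖b‖ ^ 2)⁻¹ • b := rfl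
  rw [e1, e2]
  simp
  rw [← sub_eq_zero]
  change _ • (‖b‖ ^ 2)⁻¹ • L _ + _ -
    (_ • (‖b‖ ^ 2)⁻¹ • cross3 b (H b) + _ • (‖b‖ ^ 2)⁻¹ • cross3 _ _ + _) = _
  refine Eq.trans ?_ ((congrArg (fun v => ((‖b‖ ^ 2)⁻¹ ^ 3) • v) key).trans (smul_zero _))
  change _ = (‖b‖ ^ 2)⁻¹ ^ 3 • (‖b‖ ^ 2 • (L (cross3 b g) - (cross3 (L b) g + cross3 b (H b)))
      - (2 * ⟪b, L (cross3 b g)⟫) • b + (2 * ⟪b, L b⟫) • cross3 b g)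
  have hb : ‖b‖ ≠ 0 := by simpa using hn
  match_scalars <;> field_simp

end VectorCalculus

section Isolation

/-- A regular point of a level set has a neighbourhood in which the level set lies in the
connected component of the point. -/
lemma exists_isOpen_inter_level_subset {U : Set R3} {p : R3 → ℝ} (hU : IsOpen U)
    (hp : ContDiffOn ℝ ∞ p U) {c : ℝ} {z : R3} (hzU : z ∈ U) (hzc : p z = c)
    (hz : gradient p z ≠ 0) :
    ∃ W, IsOpen W ∧ z ∈ W ∧ W ⊆ U ∧
      ∀ y ∈ W, p y = c → y ∈ connectedComponentIn {z | z ∈ U ∧ p z = c} z := by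
  have hs : HasStrictFDerivAt p (fderiv ℝ p z) z :=
    (hp.contDiffAt (hU.mem_nhds hzU)).hasStrictFDerivAt (by simp)
  have hr : (fderiv ℝ p z).range = ⊤ := by
    rw [LinearMap.range_eq_top]
    apply LinearMap.surjective
    intro h
    apply hz
    have h' : fderiv ℝ p z = 0 := by
      ext v; exact DFunLike.congr_fun h v
    simp [gradient, h']
  set e := hs.implicitToOpenPartialHomeomorph p _ hr with he
  have hzs : z ∈ e.source := hs.mem_implicitToOpenPartialHomeomorph_source hr
  have hez : e z = (c, 0) := by rw [← hzc]; exact hs.implicitToOpenPartialHomeomorph_self hr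
  have hfst : ∀ y, (e y).1 = p y := fun y => hs.implicitToOpenPartialHomeomorph_fst hr y
  have hto : IsOpen (e.target ∩ e.symm ⁻¹' U) := e.isOpen_inter_preimage_symm hU
  have hzt : (c, 0) ∈ e.target ∩ e.symm ⁻¹' U := by
    refine ⟨hez ▸ e.map_source hzs, ?_⟩
    rw [mem_preimage, ← hez, e.left_inv hzs]; exact hzU
  obtain ⟨r, hr0, hball⟩ := Metric.isOpen_iff.1 hto _ hzt
  refine ⟨e.source ∩ e ⁻¹' ball (c, 0) r, e.isOpen_inter_preimage isOpen_ball, ⟨hzs, ?_⟩, ?_, ?_⟩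
  · rw [mem_preimage, hez]; exact mem_ball_self hr0
  · rintro y ⟨hy, hy'⟩
    have := (hball hy').2
    rwa [mem_preimage, e.left_inv hy] at this
  · rintro y ⟨hy, hy'⟩ hyc
    set T : Set (ℝ × (fderiv ℝ p z).ker) := {c} ×ˢ ball 0 r with hT
    have hTb : T ⊆ ball (c, 0) r := by
      rintro ⟨a, k⟩ ⟨h1, h2⟩
      have h1a : a = c := h1
      rw [h1a, ← ball_prod_same]
      exact ⟨mem_ball_self hr0, h2⟩
    have hTp : IsPreconnected T := by
      apply isPreconnected_singleton.prod
      exact (convex_ball _ _).isPreconnected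
    have hTi : IsPreconnected (e.symm '' T) :=
      hTp.image _ (e.continuousOn_symm.mono fun x hx => (hball (hTb hx)).1)
    have hzi : z ∈ e.symm '' T :=
      ⟨(c, 0), ⟨rfl, mem_ball_self hr0⟩, by rw [← hez, e.left_inv hzs]⟩
    refine hTi.subset_connectedComponentIn hzi ?_ ⟨e y, ⟨?_, ?_⟩, e.left_inv hy⟩
    · rintro _ ⟨x, hx, rfl⟩
      refine ⟨(hball (hTb hx)).2, ?_⟩
      rw [← hfst, e.right_inv (hball (hTb hx)).1]
      exact hx.1
    · rw [mem_singleton_iff, hfst, hyc]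
    · have h : e y ∈ ball (c, 0) r := hy'
      rw [← ball_prod_same] at h
      exact h.2

end Isolation

section Cutoff

lemma smoothAction_fixed {E : Type} [NormedAddCommGroup E] [NormedSpace ℝ E] {X Y : E → E}
    (hX : ContDiff ℝ ∞ X) (hY : ContDiff ℝ ∞ Y) (hXc : HasCompactSupport X)
    (hYc : HasCompactSupport Y) {A : ℝ × ℝ → E → E} (hA0 : ∀ z, A 0 z = z)
    (hAd : ∀ w z, HasFDerivAt (fun w => A w z)
        ((ContinuousLinearMap.fst ℝ ℝ ℝ).smulRight (X (A w z)) +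
          (ContinuousLinearMap.snd ℝ ℝ ℝ).smulRight (Y (A w z))) w)
    {z : E} (hXz : X z = 0) (hYz : Y z = 0) (w : ℝ × ℝ) : A w z = z := by
  obtain ⟨C, hC⟩ := ContDiff.lipschitzWith_of_hasCompactSupport
    (f := fun x => w.1 • X x + w.2 • Y x)
    (HasCompactSupport.add hXc.smul_left hYc.smul_left)
    ((contDiff_const.smul hX).add (contDiff_const.smul hY) : ContDiff ℝ ∞ _) (by simp)
  have h := ODE_solution_unique_univ (v := fun _ x => w.1 • X x + w.2 • Y x)
    (s := fun _ => univ) (K := C) (t₀ := 0) (f := fun t => A (t • w) z) (g := fun _ => z)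
    (fun _ => hC.lipschitzOnWith)
    (fun t => ⟨by
      have := (hAd (t • w) z).comp_hasDerivAt (f := fun t : ℝ => t • w) t
        ((hasDerivAt_id t).smul_const w)
      simpa using! this, mem_univ _⟩)
    (fun t => ⟨by simpa [hXz, hYz] using hasDerivAt_const t z, mem_univ _⟩) (by simp [hA0])
  simpa using congrFun h 1

variable {U : Set R3} {B : R3 → R3} {p : R3 → ℝ}

theorem exists_isolated_action (hU : IsOpen U) (hB : ContDiffOn ℝ ∞ B U)
    (hp : ContDiffOn ℝ ∞ p U) (hBne : ∀ z ∈ U, B z ≠ 0) (hdiv : ∀ z ∈ U, divg B z = 0)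
    (hMHS : ∀ z ∈ U, cross3 (curl B z) (B z) = gradient p z) {c : ℝ} {Λ : Set R3} {z₀ : R3}
    (hΛ : Λ = connectedComponentIn {z | z ∈ U ∧ p z = c} z₀) (hΛc : IsCompact Λ)
    (hreg : ∀ z ∈ Λ, gradient p z ≠ 0) :
    ∃ (N : Set R3) (A : ℝ × ℝ → R3 → R3), IsOpen N ∧ Λ ⊆ N ∧ N ⊆ U ∧
      (∀ z ∈ N, gradient p z ≠ 0) ∧ (∀ z ∈ N, p z = c → z ∈ Λ) ∧ (∀ z, A 0 z = z) ∧
      (∀ v w z, A (v + w) z = A v (A w z)) ∧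
      ContDiff ℝ ∞ (fun q : (ℝ × ℝ) × R3 => A q.1 q.2) ∧
      (∀ w, ∀ z ∈ N, A w z ∈ N) ∧ (∀ w, ∀ z ∈ N, p (A w z) = p z) ∧
      ∀ w, ∀ z ∈ N, HasFDerivAt (fun w => A w z)
        ((ContinuousLinearMap.fst ℝ ℝ ℝ).smulRight (fieldX B (A w z)) +
          (ContinuousLinearMap.snd ℝ ℝ ℝ).smulRight (fieldY B p (A w z))) w := by
  have hΛL : Λ ⊆ {z | z ∈ U ∧ p z = c} := hΛ ▸ connectedComponentIn_subset _ _
  have hgc : ContinuousOn (gradient p) U := (contDiffOn_gradient hU hp).continuousOn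
  have hW : ∃ W, IsOpen W ∧ Λ ⊆ W ∧ W ⊆ U ∧ (∀ z ∈ W, gradient p z ≠ 0) ∧
      ∀ z ∈ W, p z = c → z ∈ Λ := by
    have h1 : ∀ z ∈ Λ, ∃ W, IsOpen W ∧ z ∈ W ∧ W ⊆ U ∧ ∀ y ∈ W, p y = c → y ∈ Λ := by
      intro z hz
      obtain ⟨W, h1, h2, h3, h4⟩ := exists_isOpen_inter_level_subset hU hp (hΛL hz).1 (hΛL hz).2
        (hreg z hz)
      refine ⟨W, h1, h2, h3, fun y hy hyc => ?_⟩
      rw [hΛ, connectedComponentIn_eq (hΛ ▸ hz)]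
      exact h4 y hy hyc
    choose! W hWo hzW hWU hWΛ using h1
    refine ⟨(⋃ z ∈ Λ, W z) ∩ (U ∩ gradient p ⁻¹' {0}ᶜ),
      (isOpen_biUnion hWo).inter (hgc.isOpen_inter_preimage hU isOpen_compl_singleton),
      fun z hz => ⟨mem_biUnion hz (hzW z hz), (hΛL hz).1, hreg z hz⟩, fun z hz => hz.2.1,
      fun z hz => hz.2.2, fun z hz hzc => ?_⟩
    obtain ⟨x, hx, hzx⟩ := mem_iUnion₂.1 hz.1
    exact hWΛ x hx z hzx hzc
  obtain ⟨W, hWo, hΛW, hWU, hWg, hWΛ⟩ := hW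
  obtain ⟨K, hK, hΛK, hKW⟩ := exists_compact_between hΛc hWo hΛW
  set V := interior K with hV
  have hVK : closure V ⊆ K := closure_minimal interior_subset hK.isClosed
  have hVo : IsOpen V := isOpen_interior
  have hVU : V ⊆ U := interior_subset.trans (hKW.trans hWU)
  have hfr : IsCompact (frontier V) :=
    hK.of_isClosed_subset isClosed_frontier (frontier_subset_closure.trans hVK)
  have hfU : frontier V ⊆ W := frontier_subset_closure.trans (hVK.trans hKW)
  have himg : IsCompact (p '' frontier V) :=
    hfr.image_of_continuousOn (hp.continuousOn.mono (hfU.trans hWU))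
  have hcn : c ∈ (p '' frontier V)ᶜ := by
    rintro ⟨y, hy, hyc⟩
    rw [hVo.frontier_eq] at hy
    exact hy.2 (hΛK (hWΛ y (hKW (hVK hy.1)) hyc))
  obtain ⟨ε, hε, hball⟩ := Metric.isOpen_iff.1 himg.isClosed.isOpen_compl c hcn
  let η : ContDiffBump c := ⟨ε / 3, ε / 2, by positivity, by linarith⟩
  classical
  set f : R3 → ℝ := fun z => if z ∈ V then η (p z) else 0 with hf
  have hfV : ∀ z ∈ V, f =ᶠ[𝓝 z] fun z => η (p z) := fun z hz => by
    filter_upwards [hVo.mem_nhds hz] with y hy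
    simp [hf, hy]
  have hf0 : ∀ z ∉ V, f =ᶠ[𝓝 z] 0 := by
    intro z hz
    by_cases hzc : z ∈ closure V
    · have hzf : z ∈ frontier V := by rw [hVo.frontier_eq]; exact ⟨hzc, hz⟩
      have hpc : ContinuousAt p z :=
        (hp.contDiffAt (hU.mem_nhds (hWU (hfU hzf)))).continuousAt
      have hd : ε ≤ dist (p z) c := by
        by_contra! h
        exact hball (mem_ball.2 h) ⟨z, hzf, rfl⟩
      have : ∀ᶠ y in 𝓝 z, ε / 2 < dist (p y) c :=
        (hpc.dist continuousAt_const).eventually_const_lt (by linarith)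
      filter_upwards [this] with y hy
      have h0 : η (p y) = 0 := η.zero_of_le_dist hy.le
      simp [hf, h0]
    · filter_upwards [isClosed_closure.isOpen_compl.mem_nhds hzc] with y hy
      have : y ∉ V := fun h => hy (subset_closure h)
      simp [hf, this]
  have hsm : ∀ Z : R3 → R3, ContDiffOn ℝ ∞ Z U → ContDiff ℝ ∞ (fun z => f z • Z z) := by
    intro Z hZ
    rw [contDiff_iff_contDiffAt]
    intro z
    by_cases hz : z ∈ V
    · have hzU := hU.mem_nhds (hVU hz)
      exact (((η.contDiff.contDiffAt).comp z (hp.contDiffAt hzU)).congr_of_eventuallyEq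
        (hfV z hz)).smul (hZ.contDiffAt hzU)
    · refine (contDiffAt_const (c := (0 : R3))).congr_of_eventuallyEq ?_
      filter_upwards [hf0 z hz] with y hy
      simp [hy]
  have hfK : HasCompactSupport f :=
    HasCompactSupport.intro hK fun z hz => by
      have : z ∉ V := fun h => hz (interior_subset h)
      simp [hf, this]
  have hXs := hsm _ (contDiffOn_fieldX hB hBne)
  have hYs := hsm _ (contDiffOn_fieldY hU hB hp hBne)
  have hXc : HasCompactSupport (fun z => f z • fieldX B z) := hfK.smul_right
  have hYc : HasCompactSupport (fun z => f z • fieldY B p z) := hfK.smul_right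
  have hcomm : ∀ z, fderiv ℝ (fun z => f z • fieldX B z) z (f z • fieldY B p z) =
      fderiv ℝ (fun z => f z • fieldY B p z) z (f z • fieldX B z) := by
    intro z
    by_cases hz : z ∈ V
    · have hzU := hU.mem_nhds (hVU hz)
      have dp : HasFDerivAt p (fderiv ℝ p z) z :=
        ((hp.contDiffAt hzU).differentiableAt (by simp)).hasFDerivAt
      have dη : HasDerivAt η (deriv η (p z)) (p z) :=
        ((η.contDiff (n := ⊤)).differentiable (by simp) _).hasDerivAt
      have df : HasFDerivAt f (deriv η (p z) • fderiv ℝ p z) z :=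
        (dη.comp_hasFDerivAt z dp).congr_of_eventuallyEq (hfV z hz)
      have dX : HasFDerivAt (fieldX B) (fderiv ℝ (fieldX B) z) z :=
        (((contDiffOn_fieldX hB hBne).contDiffAt hzU).differentiableAt (by simp)).hasFDerivAt
      have dY : HasFDerivAt (fieldY B p) (fderiv ℝ (fieldY B p) z) z :=
        (((contDiffOn_fieldY hU hB hp hBne).contDiffAt hzU).differentiableAt
          (by simp)).hasFDerivAt
      rw [(df.fun_smul dX).fderiv, (df.fun_smul dY).fderiv]
      simp [fderiv_fieldX hMHS (hVU hz), fderiv_fieldY,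
        fderiv_fieldX_fieldY hU hB hp hBne hdiv hMHS (hVU hz)]
    · have : f z = 0 := (hf0 z hz).eq_of_nhds
      simp [this]
  obtain ⟨A, hA0, hAadd, hAs, hAd⟩ := exists_smooth_plane_action hXs hYs hXc hYc hcomm
  have hfix : ∀ w z, f z = 0 → A w z = z := fun w z hz =>
    smoothAction_fixed hXs hYs hXc hYc hA0 hAd (by simp [hz]) (by simp [hz]) w
  have hne : ∀ w z, f z ≠ 0 → f (A w z) ≠ 0 := by
    intro w z hz h
    apply hz
    have h1 := hfix (-w) _ h
    rw [← hAadd, neg_add_cancel, hA0] at h1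
    rwa [← h1] at h
  have hfmem : ∀ z, f z ≠ 0 → z ∈ V := fun z hz => by
    by_contra h
    exact hz (by simp [hf, h])
  have hpA : ∀ w z, f z ≠ 0 → p (A w z) = p z := by
    intro w z hz
    have hd : ∀ w, HasFDerivAt (fun w => p (A w z)) (0 : ℝ × ℝ →L[ℝ] ℝ) w := by
      intro w
      have hzU := hVU (hfmem _ (hne w z hz))
      have := (((hp.contDiffAt (hU.mem_nhds hzU)).differentiableAt
        (by simp)).hasFDerivAt).comp w (hAd w z)
      refine this.congr_fderiv ?_
      ext <;> simp [fderiv_fieldX hMHS hzU, fderiv_fieldY]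
    have := is_const_of_fderiv_eq_zero (𝕜 := ℝ) (f := fun w => p (A w z))
      (fun w => (hd w).differentiableAt) (fun w => (hd w).fderiv) w 0
    simpa [hA0] using this
  have hf1 : ∀ z ∈ V, |p z - c| < ε / 3 → f z = 1 := by
    intro z hz h
    have : η (p z) = 1 := η.one_of_mem_closedBall (by
      rw [mem_closedBall, Real.dist_eq]; exact h.le)
    simp [hf, hz, this]
  set N := V ∩ p ⁻¹' (ball c (ε / 3)) with hN
  have hN1 : ∀ z ∈ N, f z = 1 := fun z hz => hf1 z hz.1 (by simpa [Real.dist_eq] using hz.2)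
  have hNA : ∀ w, ∀ z ∈ N, A w z ∈ N := by
    intro w z hz
    have h1 : f z ≠ 0 := by rw [hN1 z hz]; exact one_ne_zero
    refine ⟨hfmem _ (hne w z h1), ?_⟩
    rw [mem_preimage, hpA w z h1]
    exact hz.2
  refine ⟨N, A, (hp.continuousOn.mono hVU).isOpen_inter_preimage hVo isOpen_ball,
    fun z hz => ⟨hΛK hz, ?_⟩, fun z hz => hVU hz.1, fun z hz => hWg z (hKW (interior_subset hz.1)),
    fun z hz => hWΛ z (hKW (interior_subset hz.1)), hA0, hAadd, hAs, hNA, ?_, ?_⟩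
  · rw [mem_preimage, (hΛL hz).2]; exact mem_ball_self (by positivity)
  · intro w z hz
    exact hpA w z (by rw [hN1 z hz]; exact one_ne_zero)
  · intro w z hz
    have := hAd w z
    simpa only [hN1 _ (hNA w z hz), one_smul] using this

end Cutoff

/-- An action of the plane on `ℝ³` preserving an open set `N` and a function `p` without
critical points in `N`, and generated in `N` by two pointwise independent fields `X` and `Y`. -/
structure IsSurfaceAction (N : Set R3) (p : R3 → ℝ) (X Y : R3 → R3)
    (A : ℝ × ℝ → R3 → R3) : Prop where
  isOpen : IsOpen N
  contDiffOn : ContDiffOn ℝ ∞ p N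
  gradient_ne : ∀ z ∈ N, gradient p z ≠ 0
  fderiv_fst : ∀ z ∈ N, fderiv ℝ p z (X z) = 0
  fderiv_snd : ∀ z ∈ N, fderiv ℝ p z (Y z) = 0
  indep : ∀ z ∈ N, ∀ a b : ℝ, a • X z + b • Y z = 0 → a = 0 ∧ b = 0
  zero : ∀ z, A 0 z = z
  add : ∀ v w z, A (v + w) z = A v (A w z)
  contDiff : ContDiff ℝ ∞ (fun q : (ℝ × ℝ) × R3 => A q.1 q.2)
  mapsTo : ∀ w, ∀ z ∈ N, A w z ∈ N
  p_eq : ∀ w, ∀ z ∈ N, p (A w z) = p z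
  hasFDerivAt : ∀ w, ∀ z ∈ N, HasFDerivAt (fun w => A w z)
    ((ContinuousLinearMap.fst ℝ ℝ ℝ).smulRight (X (A w z)) +
      (ContinuousLinearMap.snd ℝ ℝ ℝ).smulRight (Y (A w z))) w

/-- The map sweeping out by the action the segment through `z` with direction `u`. -/
def actionTube (A : ℝ × ℝ → R3 → R3) (z u : R3) (q : ℝ × (ℝ × ℝ)) : R3 :=
  A q.2 (z + q.1 • u)

namespace IsSurfaceAction

variable {N : Set R3} {p : R3 → ℝ} {X Y : R3 → R3} {A : ℝ × ℝ → R3 → R3}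

theorem contDiff_tube (h : IsSurfaceAction N p X Y A) (z u : R3) :
    ContDiff ℝ ∞ (actionTube A z u) :=
  h.contDiff.comp (g := fun q : (ℝ × ℝ) × R3 => A q.1 q.2)
    (f := fun q : ℝ × (ℝ × ℝ) => (q.2, z + q.1 • u)) (by fun_prop)

theorem differentiableAt_p (h : IsSurfaceAction N p X Y A) {z : R3} (hz : z ∈ N) :
    DifferentiableAt ℝ p z :=
  (h.contDiffOn.contDiffAt (h.isOpen.mem_nhds hz)).differentiableAt (by simp)

theorem neg_apply (h : IsSurfaceAction N p X Y A) (w : ℝ × ℝ) (z : R3) : A (-w) (A w z) = z := by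
  rw [← h.add, neg_add_cancel, h.zero]

theorem fderiv_tube_inr (h : IsSurfaceAction N p X Y A) {z u : R3} {q : ℝ × (ℝ × ℝ)}
    (hq : z + q.1 • u ∈ N) (w : ℝ × ℝ) :
    fderiv ℝ (actionTube A z u) q (0, w) =
      w.1 • X (actionTube A z u q) + w.2 • Y (actionTube A z u q) := by
  have h1 : HasFDerivAt (actionTube A z u) (fderiv ℝ (actionTube A z u) q) (q.1, q.2) :=
    ((h.contDiff_tube z u).differentiable (by simp) q).hasFDerivAt
  have h2 := h1.comp q.2 (hasFDerivAt_prodMk_right q.1 q.2)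
  have h3 := h2.unique (h.hasFDerivAt q.2 _ hq)
  have := DFunLike.congr_fun h3 w
  simpa [actionTube] using this

theorem p_tube (h : IsSurfaceAction N p X Y A) {z u : R3} {q : ℝ × (ℝ × ℝ)}
    (hq : z + q.1 • u ∈ N) : p (actionTube A z u q) = p (z + q.1 • u) :=
  h.p_eq _ _ hq

theorem fderiv_p_fderiv_tube (h : IsSurfaceAction N p X Y A) {z u : R3} {q : ℝ × (ℝ × ℝ)}
    (hq : z + q.1 • u ∈ N) (v : ℝ × (ℝ × ℝ)) :
    fderiv ℝ p (actionTube A z u q) (fderiv ℝ (actionTube A z u) q v) =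
      v.1 * fderiv ℝ p (z + q.1 • u) u := by
  have h1 : HasFDerivAt (actionTube A z u) (fderiv ℝ (actionTube A z u) q) q :=
    ((h.contDiff_tube z u).differentiable (by simp) q).hasFDerivAt
  have h2 := ((h.differentiableAt_p (h.mapsTo q.2 _ hq)).hasFDerivAt).comp q h1
  have hσ : HasFDerivAt (fun q : ℝ × (ℝ × ℝ) => z + q.1 • u)
      ((ContinuousLinearMap.fst ℝ ℝ (ℝ × ℝ)).smulRight u) q :=
    ((ContinuousLinearMap.fst ℝ ℝ (ℝ × ℝ)).smulRight u).hasFDerivAt.const_add z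
  have h3 := ((h.differentiableAt_p hq).hasFDerivAt).comp q hσ
  have hev : p ∘ actionTube A z u =ᶠ[𝓝 q] p ∘ fun q : ℝ × (ℝ × ℝ) => z + q.1 • u := by
    filter_upwards [hσ.continuousAt.preimage_mem_nhds (h.isOpen.mem_nhds hq)] with r hr
    exact h.p_tube hr
  have h4 := h2.unique (h3.congr_of_eventuallyEq hev)
  have := DFunLike.congr_fun h4 v
  simpa [actionTube] using this

theorem injective_fderiv_tube (h : IsSurfaceAction N p X Y A) {z u : R3} {q : ℝ × (ℝ × ℝ)}
    (hq : z + q.1 • u ∈ N) (hd : fderiv ℝ p (z + q.1 • u) u ≠ 0) :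
    Function.Injective (fderiv ℝ (actionTube A z u) q) := by
  rw [injective_iff_map_eq_zero]
  rintro ⟨s, w⟩ h0
  have h1 := h.fderiv_p_fderiv_tube hq (s, w)
  rw [h0, map_zero, eq_comm, mul_eq_zero, or_iff_left hd] at h1
  simp only at h1
  subst h1
  rw [h.fderiv_tube_inr hq] at h0
  obtain ⟨h2, h3⟩ := h.indep _ (h.mapsTo q.2 _ hq) _ _ h0
  exact Prod.ext rfl (Prod.ext h2 h3)

/-- Near a point of a transversal segment the tube map is a local diffeomorphism. -/
theorem exists_local_inverse (h : IsSurfaceAction N p X Y A) {z u : R3} {I : Set ℝ}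
    (hI : IsOpen I) (hIN : ∀ τ ∈ I, z + τ • u ∈ N)
    (hd : ∀ τ ∈ I, fderiv ℝ p (z + τ • u) u ≠ 0) {τ : ℝ} (hτ : τ ∈ I) (w : ℝ × ℝ) :
    ∃ e : OpenPartialHomeomorph (ℝ × (ℝ × ℝ)) R3, (τ, w) ∈ e.source ∧
      ⇑e = actionTube A z u ∧ (∀ q ∈ e.source, q.1 ∈ I) ∧
      ContDiffOn ℝ ∞ e.symm e.target := by
  have key : ∀ q : ℝ × (ℝ × ℝ), q.1 ∈ I → ∃ L : (ℝ × (ℝ × ℝ)) ≃L[ℝ] R3,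
      HasFDerivAt (actionTube A z u) (L : (ℝ × (ℝ × ℝ)) →L[ℝ] R3) q := by
    intro q hq
    have hinj := h.injective_fderiv_tube (q := q) (hIN _ hq) (hd _ hq)
    let L0 := LinearMap.linearEquivOfInjective
      (fderiv ℝ (actionTube A z u) q).toLinearMap hinj (by simp [R3])
    refine ⟨L0.toContinuousLinearEquiv, ?_⟩
    refine ((h.contDiff_tube z u).differentiable (by simp) q).hasFDerivAt.congr_fderiv ?_
    ext v <;> rfl
  obtain ⟨L, hL⟩ := key (τ, w) hτ
  have hF : ∀ q, ContDiffAt ℝ ∞ (actionTube A z u) q := fun q => (h.contDiff_tube z u).contDiffAt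
  let e₀ := (hF (τ, w)).toOpenPartialHomeomorph _ hL (by simp)
  have hS : IsOpen (I ×ˢ (univ : Set (ℝ × ℝ))) := hI.prod isOpen_univ
  refine ⟨e₀.restrOpen _ hS, ?_, rfl, ?_, ?_⟩
  · exact ⟨(hF (τ, w)).mem_toOpenPartialHomeomorph_source hL (by simp), hτ, mem_univ _⟩
  · intro q hq
    exact hq.2.1
  · intro y hy
    have hy' := (e₀.restrOpen _ hS).map_target hy
    obtain ⟨L', hL'⟩ := key _ hy'.2.1
    exact ((e₀.restrOpen _ hS).contDiffAt_symm hy hL' (hF _)).contDiffWithinAt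

end IsSurfaceAction

/-- A discrete cocompact subgroup of the plane has a basis of two independent vectors. -/
theorem exists_basis_of_discrete_cocompact (Γ : AddSubgroup (ℝ × ℝ)) {ε R : ℝ} (hε : 0 < ε)
    (hdisc : ∀ w ∈ Γ, ‖w‖ < ε → w = 0) (hco : ∀ v, ∃ w, ‖w‖ ≤ R ∧ v - w ∈ Γ) :
    ∃ b₁ b₂ : ℝ × ℝ, b₁.1 * b₂.2 - b₁.2 * b₂.1 ≠ 0 ∧
      ∀ w, w ∈ Γ ↔ ∃ m n : ℤ, w = (m : ℝ) • b₁ + (n : ℝ) • b₂ := by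
  let L : Submodule ℤ (ℝ × ℝ) := AddSubgroup.toIntSubmodule Γ
  have hL : ∀ w, w ∈ L ↔ w ∈ Γ := fun w => Iff.rfl
  have hD : DiscreteTopology L := by
    refine discreteTopology_of_isOpen_singleton_zero ?_
    have : ({0} : Set L) = ball 0 ε := by
      ext w
      rw [mem_singleton_iff, mem_ball_zero_iff]
      constructor
      · rintro rfl
        simpa using hε
      · intro hw
        exact Subtype.ext (hdisc _ w.2 hw)
    rw [this]
    exact isOpen_ball
  have hZ : IsZLattice ℝ L := by
    refine ⟨?_⟩
    by_contra hne
    obtain ⟨f, hf0, hf⟩ := Submodule.exists_le_ker_of_lt_top _ (lt_top_iff_ne_top.2 hne)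
    obtain ⟨v, hv⟩ : ∃ v, f v ≠ 0 := by
      by_contra! h
      exact hf0 (LinearMap.ext h)
    let f' := LinearMap.toContinuousLinearMap f
    have hb : ∀ u, |f u| ≤ ‖f'‖ * R := by
      intro u
      obtain ⟨w, hw, hu⟩ := hco u
      have h0 : f (u - w) = 0 := hf (Submodule.subset_span hu)
      rw [map_sub, sub_eq_zero] at h0
      rw [h0]
      exact (f'.le_opNorm w).trans (mul_le_mul_of_nonneg_left hw (norm_nonneg _))
    have h1 := hb (((‖f'‖ * R + 1) / f v) • v)
    rw [map_smul, smul_eq_mul, div_mul_cancel₀ _ hv] at h1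
    linarith [le_abs_self (‖f'‖ * R + 1)]
  have := ZLattice.module_finite ℝ L
  have := ZLattice.module_free ℝ L
  have hrank : Module.finrank ℤ L = 2 := by
    rw [ZLattice.rank ℝ L]
    simp
  let b := Module.finBasisOfFinrankEq ℤ L hrank
  let b' := b.ofZLatticeBasis ℝ L
  have hspan : Submodule.span ℤ (Set.range b') = L := b.ofZLatticeBasis_span ℝ
  refine ⟨b' 0, b' 1, ?_, ?_⟩
  · intro h0
    have hli : LinearIndependent ℝ ![b' 0, b' 1] := by
      have h01 : ![b' 0, b' 1] = b' := by
        funext i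
        fin_cases i <;> rfl
      rw [h01]
      exact b'.linearIndependent
    rw [LinearIndependent.pair_iff] at hli
    have h1 := hli (b' 1).2 (-(b' 0).2) (Prod.ext (by simp; linarith) (by simp; ring))
    have h2 := hli (b' 1).1 (-(b' 0).1) (Prod.ext (by simp; ring) (by simp; linarith))
    exact b'.ne_zero 0 (Prod.ext (by simpa using h2.2) (by simpa using h1.2))
  · intro w
    rw [← hL, ← hspan, Submodule.mem_span_range_iff_exists_fun]
    constructor
    · rintro ⟨a, ha⟩
      refine ⟨a 0, a 1, ?_⟩
      rw [← ha, Fin.sum_univ_two]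
      simp only [Int.cast_smul_eq_zsmul]
    · rintro ⟨m, n, rfl⟩
      refine ⟨![m, n], ?_⟩
      rw [Fin.sum_univ_two]
      simp only [Int.cast_smul_eq_zsmul]
      rfl

namespace IsSurfaceAction

variable {N : Set R3} {p : R3 → ℝ} {X Y : R3 → R3} {A : ℝ × ℝ → R3 → R3}

/-- The translations fixing a given point. -/
def stabilizer (h : IsSurfaceAction N p X Y A) (z : R3) : AddSubgroup (ℝ × ℝ) where
  carrier := {w | A w z = z}
  zero_mem' := h.zero z
  add_mem' := by
    intro v w hv hw
    rw [mem_ofPred_eq] at hv hw ⊢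
    rw [h.add, hw, hv]
  neg_mem' := by
    intro w hw
    rw [mem_ofPred_eq] at hw ⊢
    have := h.neg_apply w z
    rwa [hw] at this

theorem mem_stabilizer (h : IsSurfaceAction N p X Y A) {z : R3} {w : ℝ × ℝ} :
    w ∈ h.stabilizer z ↔ A w z = z := Iff.rfl

/-- The gradient direction is transversal to the level sets on a short segment. -/
theorem exists_transversal (h : IsSurfaceAction N p X Y A) {z : R3} (hz : z ∈ N) :
    ∃ δ > 0, (∀ τ ∈ Ioo (-δ) δ, z + τ • gradient p z ∈ N) ∧
      (∀ τ ∈ Ioo (-δ) δ, fderiv ℝ p (z + τ • gradient p z) (gradient p z) ≠ 0) ∧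
      StrictMonoOn (fun τ : ℝ => p (z + τ • gradient p z)) (Ioo (-δ) δ) := by
  set u := gradient p z with hu
  have hσ : Continuous (fun τ : ℝ => z + τ • u) := by fun_prop
  have h0 : z + (0 : ℝ) • u = z := by simp
  have hc : ContinuousAt (fun τ : ℝ => fderiv ℝ p (z + τ • u) u) 0 := by
    have h1 : ContinuousAt (fderiv ℝ p) (z + (0 : ℝ) • u) := by
      rw [h0]
      exact (h.contDiffOn.continuousOn_fderiv_of_isOpen h.isOpen (by simp)).continuousAt
        (h.isOpen.mem_nhds hz)
    exact (h1.comp (f := fun τ : ℝ => z + τ • u) hσ.continuousAt).clm_apply continuousAt_const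
  have hpos : 0 < fderiv ℝ p (z + (0 : ℝ) • u) u := by
    rw [h0, ← inner_gradient, real_inner_self_eq_norm_sq]
    have := norm_pos_iff.2 (h.gradient_ne z hz)
    positivity
  have hev : ∀ᶠ τ : ℝ in 𝓝 0, z + τ • u ∈ N ∧ 0 < fderiv ℝ p (z + τ • u) u :=
    (hσ.continuousAt.eventually_mem (by rw [h0]; exact h.isOpen.mem_nhds hz)).and
      (hc.eventually_const_lt hpos)
  obtain ⟨δ, hδ, hball⟩ := Metric.eventually_nhds_iff_ball.1 hev
  rw [Real.ball_eq_Ioo, zero_sub, zero_add] at hball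
  refine ⟨δ, hδ, fun τ hτ => (hball τ hτ).1, fun τ hτ => (hball τ hτ).2.ne', ?_⟩
  have hder : ∀ τ ∈ Ioo (-δ) δ, HasDerivAt (fun τ : ℝ => p (z + τ • u))
      (fderiv ℝ p (z + τ • u) u) τ := by
    intro τ hτ
    have h2 : HasDerivAt (fun τ : ℝ => z + τ • u) u τ := by
      simpa using ((hasDerivAt_id τ).smul_const u).const_add z
    exact ((h.differentiableAt_p (hball τ hτ).1).hasFDerivAt).comp_hasDerivAt τ h2
  refine strictMonoOn_of_deriv_pos (convex_Ioo _ _)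
    (fun τ hτ => (hder τ hτ).continuousAt.continuousWithinAt) ?_
  intro τ hτ
  rw [interior_Ioo] at hτ
  rw [(hder τ hτ).deriv]
  exact (hball τ hτ).2

theorem eventually_free (h : IsSurfaceAction N p X Y A) {z : R3} (hz : z ∈ N) :
    ∃ ε > 0, ∀ w, ‖w‖ < ε → A w z = z → w = 0 := by
  obtain ⟨δ, hδ, h1, h2, -⟩ := h.exists_transversal hz
  have h0 : (0 : ℝ) ∈ Ioo (-δ) δ := ⟨by linarith, hδ⟩
  obtain ⟨e, he, hecoe, -, -⟩ := h.exists_local_inverse isOpen_Ioo h1 h2 h0 0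
  have hev : ∀ᶠ w : ℝ × ℝ in 𝓝 0, ((0 : ℝ), w) ∈ e.source :=
    (Continuous.prodMk_right (0 : ℝ)).continuousAt.eventually_mem (e.open_source.mem_nhds he)
  obtain ⟨ε, hε, hball⟩ := Metric.eventually_nhds_iff_ball.1 hev
  refine ⟨ε, hε, fun w hw hA => ?_⟩
  have := e.injOn (hball w (by simpa using hw)) he (by simp [hecoe, actionTube, hA, h.zero])
  exact (Prod.ext_iff.1 this).2

theorem eventually_transitive (h : IsSurfaceAction N p X Y A) {z : R3} (hz : z ∈ N) :
    ∀ᶠ y in 𝓝 z, p y = p z → ∃ w, ‖w‖ < 1 ∧ A w z = y := by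
  obtain ⟨δ, hδ, h1, h2, hmono⟩ := h.exists_transversal hz
  have h0 : (0 : ℝ) ∈ Ioo (-δ) δ := ⟨by linarith, hδ⟩
  obtain ⟨e, he, hecoe, hI, -⟩ := h.exists_local_inverse isOpen_Ioo h1 h2 h0 0
  have hez : e (0, 0) = z := by simp [hecoe, actionTube, h.zero]
  have hz' : z ∈ e.target := by rw [← hez]; exact e.map_source he
  have hes : e.symm z = (0, 0) := by rw [← hez]; exact e.left_inv he
  have hcont : ContinuousAt (fun y => (e.symm y).2) z :=
    continuous_snd.continuousAt.comp (e.continuousAt_symm hz')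
  have hev : ∀ᶠ y in 𝓝 z, (e.symm y).2 ∈ ball (0 : ℝ × ℝ) 1 :=
    hcont.eventually_mem (by rw [hes]; exact ball_mem_nhds _ one_pos)
  filter_upwards [hev, e.open_target.mem_nhds hz'] with y hy hyt hpy
  refine ⟨(e.symm y).2, by simpa using hy, ?_⟩
  have h3 := e.right_inv hyt
  rw [hecoe] at h3
  have hτ := hI _ (e.map_target hyt)
  have h4 := h.p_tube (h1 _ hτ)
  rw [h3, hpy] at h4
  have h5 : (e.symm y).1 = 0 := hmono.injOn hτ h0 (by simpa using h4.symm)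
  simpa [actionTube, h5] using h3

/-- An isolated compact connected level set is a single orbit, with a lattice of periods. -/
theorem exists_period_lattice (h : IsSurfaceAction N p X Y A) {Λ : Set R3} {c : ℝ}
    (hΛ : IsPreconnected Λ) (hΛc : IsCompact Λ) (hΛN : Λ ⊆ N) (hpΛ : ∀ z ∈ Λ, p z = c)
    (hNΛ : ∀ z ∈ N, p z = c → z ∈ Λ) {z₀ : R3} (hz₀ : z₀ ∈ Λ) :
    ∃ b₁ b₂ : ℝ × ℝ, b₁.1 * b₂.2 - b₁.2 * b₂.1 ≠ 0 ∧
      (∀ w, A w z₀ = z₀ ↔ ∃ m n : ℤ, w = (m : ℝ) • b₁ + (n : ℝ) • b₂) ∧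
      ∀ y ∈ Λ, ∃ w, A w z₀ = y := by
  have htrans : ∀ y ∈ Λ, ∃ w, A w z₀ = y := by
    intro y hy
    refine hΛ.induction₂ (fun x y => ∃ w, A w x = y) ?_ ?_ ?_ hz₀ hy
    · intro x hx
      filter_upwards [nhdsWithin_le_nhds (h.eventually_transitive (hΛN hx)),
        self_mem_nhdsWithin] with y hy hyΛ
      obtain ⟨w, -, hw⟩ := hy (by rw [hpΛ y hyΛ, hpΛ x hx])
      exact ⟨w, hw⟩
    · rintro x y z - - - ⟨v, rfl⟩ ⟨w, rfl⟩
      exact ⟨w + v, h.add _ _ _⟩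
    · rintro x y - - ⟨v, rfl⟩
      exact ⟨-v, h.neg_apply _ _⟩
  obtain ⟨R, hR⟩ : ∃ R : ℝ, ∀ y ∈ Λ, ∃ w, ‖w‖ ≤ R ∧ A w z₀ = y := by
    refine hΛc.induction_on (p := fun s => ∃ R : ℝ, ∀ y ∈ s, ∃ w, ‖w‖ ≤ R ∧ A w z₀ = y)
      ⟨0, by simp⟩ ?_ ?_ ?_
    · rintro s t hst ⟨R, hR⟩
      exact ⟨R, fun y hy => hR y (hst hy)⟩
    · rintro s t ⟨R, hR⟩ ⟨S, hS⟩
      refine ⟨max R S, ?_⟩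
      rintro y (hy | hy)
      · obtain ⟨w, hw, h1⟩ := hR y hy
        exact ⟨w, hw.trans (le_max_left _ _), h1⟩
      · obtain ⟨w, hw, h1⟩ := hS y hy
        exact ⟨w, hw.trans (le_max_right _ _), h1⟩
    · intro x hx
      obtain ⟨v, rfl⟩ := htrans x hx
      have hev := nhdsWithin_le_nhds (s := Λ) (h.eventually_transitive (hΛN hx))
      refine ⟨_, inter_mem self_mem_nhdsWithin hev, 1 + ‖v‖, ?_⟩
      rintro y ⟨hyΛ, hy⟩
      obtain ⟨w, hw, rfl⟩ := hy (by rw [hpΛ y hyΛ, hpΛ _ hx])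
      exact ⟨w + v, (norm_add_le _ _).trans (by linarith), h.add _ _ _⟩
  obtain ⟨ε, hε, hfree⟩ := h.eventually_free (hΛN hz₀)
  have hΛA : ∀ v, A v z₀ ∈ Λ := fun v => hNΛ _ (h.mapsTo v _ (hΛN hz₀)) (by
    rw [h.p_eq v _ (hΛN hz₀), hpΛ _ hz₀])
  obtain ⟨b₁, b₂, hb, hΓ⟩ := exists_basis_of_discrete_cocompact (h.stabilizer z₀) hε
    (fun w hw hn => hfree w hn hw) (R := R) (by
      intro v
      obtain ⟨w, hw, hwv⟩ := hR _ (hΛA v)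
      refine ⟨w, hw, ?_⟩
      change A (v - w) z₀ = z₀
      rw [sub_eq_neg_add, h.add, ← hwv, h.neg_apply])
  exact ⟨b₁, b₂, hb, hΓ, htrans⟩

end IsSurfaceAction

theorem eq_of_smul_add_smul_eq {a b : ℝ × ℝ} (hab : a.1 * b.2 - a.2 * b.1 ≠ 0) {x y x' y' : ℝ}
    (h : x • a + y • b = x' • a + y' • b) : x = x' ∧ y = y' := by
  have h1 := congrArg Prod.fst h
  have h2 := congrArg Prod.snd h
  simp only [Prod.fst_add, Prod.snd_add, Prod.smul_fst, Prod.smul_snd, smul_eq_mul] at h1 h2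
  constructor
  · apply mul_left_cancel₀ hab
    linear_combination b.2 * h1 - b.1 * h2
  · apply mul_left_cancel₀ hab
    linear_combination a.1 * h2 - a.2 * h1

theorem exists_smul_add_smul_eq {a b : ℝ × ℝ} (hab : a.1 * b.2 - a.2 * b.1 ≠ 0) (w : ℝ × ℝ) :
    ∃ x y : ℝ, w = x • a + y • b := by
  refine ⟨(w.1 * b.2 - w.2 * b.1) / (a.1 * b.2 - a.2 * b.1),
    (a.1 * w.2 - a.2 * w.1) / (a.1 * b.2 - a.2 * b.1), Prod.ext ?_ ?_⟩
  · simp only [Prod.fst_add, Prod.smul_fst, smul_eq_mul]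
    rw [div_mul_eq_mul_div, div_mul_eq_mul_div, ← add_div, eq_div_iff hab]
    ring
  · simp only [Prod.snd_add, Prod.smul_snd, smul_eq_mul]
    rw [div_mul_eq_mul_div, div_mul_eq_mul_div, ← add_div, eq_div_iff hab]
    ring

namespace IsSurfaceAction

variable {N : Set R3} {p : R3 → ℝ} {X Y : R3 → R3} {A : ℝ × ℝ → R3 → R3}

/-- A period at `z` extends to a smooth family of periods along a transversal segment. -/
theorem exists_period_extension (h : IsSurfaceAction N p X Y A) {z u : R3} {δ : ℝ} (hδ : 0 < δ)
    (hN : ∀ τ ∈ Ioo (-δ) δ, z + τ • u ∈ N)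
    (hd : ∀ τ ∈ Ioo (-δ) δ, fderiv ℝ p (z + τ • u) u ≠ 0)
    (hmono : StrictMonoOn (fun τ : ℝ => p (z + τ • u)) (Ioo (-δ) δ)) {b : ℝ × ℝ}
    (hb : A b z = z) :
    ∃ v : ℝ → ℝ × ℝ, v 0 = b ∧ (∀ᶠ τ in 𝓝 0, ContDiffAt ℝ ∞ v τ) ∧
      ∀ᶠ τ in 𝓝 0, A (v τ) (z + τ • u) = z + τ • u := by
  have h0 : (0 : ℝ) ∈ Ioo (-δ) δ := ⟨by linarith, hδ⟩
  obtain ⟨e, he, hecoe, hI, hes⟩ := h.exists_local_inverse isOpen_Ioo hN hd h0 b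
  have hez : e (0, b) = z := by simp [hecoe, actionTube, hb]
  have hz' : z + (0 : ℝ) • u ∈ e.target := by
    rw [zero_smul, add_zero, ← hez]
    exact e.map_source he
  have hσ : Continuous (fun τ : ℝ => z + τ • u) := by fun_prop
  refine ⟨fun τ => (e.symm (z + τ • u)).2, ?_, ?_, ?_⟩
  · have := e.left_inv he
    rw [hez] at this
    simp [this]
  · filter_upwards [hσ.continuousAt.eventually_mem (e.open_target.mem_nhds hz')] with τ hτ
    have h1 : ContDiffAt ℝ ∞ e.symm (z + τ • u) := hes.contDiffAt (e.open_target.mem_nhds hτ)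
    have h2 : ContDiffAt ℝ ∞ (fun τ : ℝ => z + τ • u) τ := by fun_prop
    exact contDiff_snd.contDiffAt.comp τ (ContDiffAt.comp τ h1 h2)
  · filter_upwards [hσ.continuousAt.eventually_mem (e.open_target.mem_nhds hz'),
      isOpen_Ioo.mem_nhds h0] with τ hτ hτI
    have h3 := e.right_inv hτ
    rw [hecoe] at h3
    have hq := hI _ (e.map_target hτ)
    have h4 := h.p_tube (hN _ hq)
    rw [h3] at h4
    have h5 : (e.symm (z + τ • u)).1 = τ := hmono.injOn hq hτI h4.symm
    rwa [actionTube, h5] at h3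

/-- The period lattice of a point extends to a smooth family of lattices along a transversal
segment. -/
theorem exists_period_family (h : IsSurfaceAction N p X Y A) {z u : R3} {δ : ℝ} (hδ : 0 < δ)
    (hN : ∀ τ ∈ Ioo (-δ) δ, z + τ • u ∈ N)
    (hd : ∀ τ ∈ Ioo (-δ) δ, fderiv ℝ p (z + τ • u) u ≠ 0)
    (hmono : StrictMonoOn (fun τ : ℝ => p (z + τ • u)) (Ioo (-δ) δ)) {b₁ b₂ : ℝ × ℝ}
    (hb : b₁.1 * b₂.2 - b₁.2 * b₂.1 ≠ 0)
    (hlat : ∀ w, A w z = z ↔ ∃ m n : ℤ, w = (m : ℝ) • b₁ + (n : ℝ) • b₂) :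
    ∃ (η : ℝ) (ω₁ ω₂ : ℝ → ℝ × ℝ), 0 < η ∧ η ≤ δ ∧
      ContDiffOn ℝ ∞ ω₁ (Ioo (-η) η) ∧ ContDiffOn ℝ ∞ ω₂ (Ioo (-η) η) ∧
      (∀ τ ∈ Ioo (-η) η, (ω₁ τ).1 * (ω₂ τ).2 - (ω₁ τ).2 * (ω₂ τ).1 ≠ 0) ∧
      ∀ τ ∈ Ioo (-η) η, ∀ x y : ℝ, A (x • ω₁ τ + y • ω₂ τ) (z + τ • u) = z + τ • u ↔
        (∃ m : ℤ, x = m) ∧ ∃ n : ℤ, y = n := by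
  have h0 : (0 : ℝ) ∈ Ioo (-δ) δ := ⟨by linarith, hδ⟩
  obtain ⟨ω₁, h10, h1e, h1⟩ := h.exists_period_extension hδ hN hd hmono (b := b₁)
    ((hlat _).2 ⟨1, 0, by simp⟩)
  obtain ⟨ω₂, h20, h2e, h2⟩ := h.exists_period_extension hδ hN hd hmono (b := b₂)
    ((hlat _).2 ⟨0, 1, by simp⟩)
  have h1s := h1e.self_of_nhds
  have h2s := h2e.self_of_nhds
  have hper : ∀ τ, A (ω₁ τ) (z + τ • u) = z + τ • u → A (ω₂ τ) (z + τ • u) = z + τ • u →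
      ∀ m n : ℤ, (m : ℝ) • ω₁ τ + (n : ℝ) • ω₂ τ ∈ h.stabilizer (z + τ • u) := by
    intro τ hτ1 hτ2 m n
    rw [Int.cast_smul_eq_zsmul, Int.cast_smul_eq_zsmul]
    exact add_mem (zsmul_mem (h.mem_stabilizer.2 hτ1) m) (zsmul_mem (h.mem_stabilizer.2 hτ2) n)
  have hdet : ∀ᶠ τ in 𝓝 (0 : ℝ), (ω₁ τ).1 * (ω₂ τ).2 - (ω₁ τ).2 * (ω₂ τ).1 ≠ 0 := by
    have hc : ContinuousAt (fun τ => (ω₁ τ).1 * (ω₂ τ).2 - (ω₁ τ).2 * (ω₂ τ).1) 0 :=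
      ((h1s.continuousAt.fst).mul h2s.continuousAt.snd).sub
        ((h1s.continuousAt.snd).mul h2s.continuousAt.fst)
    exact hc.eventually_ne (by rwa [h10, h20])
  have hgood : ∀ᶠ τ in 𝓝 (0 : ℝ), A (ω₁ τ) (z + τ • u) = z + τ • u ∧
      A (ω₂ τ) (z + τ • u) = z + τ • u ∧
      (ω₁ τ).1 * (ω₂ τ).2 - (ω₁ τ).2 * (ω₂ τ).1 ≠ 0 := h1.and (h2.and hdet)
  have hcell : ∀ᶠ τ in 𝓝 (0 : ℝ), ∀ k ∈ Icc (0 : ℝ) 1 ×ˢ Icc (0 : ℝ) 1,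
      A (k.1 • ω₁ τ + k.2 • ω₂ τ) (z + τ • u) = z + τ • u →
        (∃ m : ℤ, k.1 = m) ∧ ∃ n : ℤ, k.2 = n := by
    refine (isCompact_Icc.prod isCompact_Icc).eventually_forall_of_forall_eventually ?_
    intro k _
    have hw : ContinuousAt (fun r : ℝ × (ℝ × ℝ) => r.2.1 • ω₁ r.1 + r.2.2 • ω₂ r.1) (0, k) := by
      have c1 : ContinuousAt (fun r : ℝ × (ℝ × ℝ) => ω₁ r.1) (0, k) :=
        ContinuousAt.comp (f := fun r : ℝ × (ℝ × ℝ) => r.1) h1s.continuousAt continuousAt_fst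
      have c2 : ContinuousAt (fun r : ℝ × (ℝ × ℝ) => ω₂ r.1) (0, k) :=
        ContinuousAt.comp (f := fun r : ℝ × (ℝ × ℝ) => r.1) h2s.continuousAt continuousAt_fst
      exact (continuousAt_snd.fst.smul c1).add (continuousAt_snd.snd.smul c2)
    by_cases hk : A (k.1 • b₁ + k.2 • b₂) z = z
    · obtain ⟨m, n, hmn⟩ := (hlat _).1 hk
      obtain ⟨hkm, hkn⟩ := eq_of_smul_add_smul_eq hb hmn
      obtain ⟨e, he, hecoe, -, -⟩ := h.exists_local_inverse isOpen_Ioo hN hd h0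
        (k.1 • b₁ + k.2 • b₂)
      have hm1 : ContinuousAt (fun r : ℝ × (ℝ × ℝ) =>
          (r.1, r.2.1 • ω₁ r.1 + r.2.2 • ω₂ r.1)) (0, k) := continuousAt_fst.prodMk hw
      have hm2 : ContinuousAt (fun r : ℝ × (ℝ × ℝ) => ((r.1, k) : ℝ × (ℝ × ℝ))) (0, k) :=
        continuousAt_fst.prodMk continuousAt_const
      have hm3 := ContinuousAt.comp_of_eq (f := fun r : ℝ × (ℝ × ℝ) => ((r.1, k) : ℝ × (ℝ × ℝ)))
        hm1 hm2 rfl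
      have hs := e.open_source.mem_nhds he
      have hev1 := hm1.eventually_mem (s := e.source) (by simpa [h10, h20] using hs)
      have hev2 := hm3.eventually_mem (s := e.source) (by simpa [h10, h20] using hs)
      have hev3 := (continuousAt_fst : ContinuousAt Prod.fst ((0 : ℝ), k)).eventually hgood
      filter_upwards [hev1, hev2, hev3] with r hr1 hr2 hr3 hA
      have hA2 := h.mem_stabilizer.1 (hper r.1 hr3.1 hr3.2.1 m n)
      rw [← hkm, ← hkn] at hA2
      have := e.injOn hr1 hr2 (by
        rw [hecoe]
        exact hA.trans hA2.symm)
      obtain ⟨h3, h4⟩ := eq_of_smul_add_smul_eq hr3.2.2 (Prod.ext_iff.1 this).2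
      exact ⟨⟨m, h3.trans hkm⟩, n, h4.trans hkn⟩
    · have hσ : ContinuousAt (fun r : ℝ × (ℝ × ℝ) => z + r.1 • u) (0, k) := by fun_prop
      have hA : ContinuousAt (fun r : ℝ × (ℝ × ℝ) =>
          A (r.2.1 • ω₁ r.1 + r.2.2 • ω₂ r.1) (z + r.1 • u)) (0, k) :=
        ContinuousAt.comp (g := fun q : (ℝ × ℝ) × R3 => A q.1 q.2)
          (f := fun r : ℝ × (ℝ × ℝ) => (r.2.1 • ω₁ r.1 + r.2.2 • ω₂ r.1, z + r.1 • u))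
          h.contDiff.continuous.continuousAt (hw.prodMk hσ)
      have hne := (hA.sub hσ).eventually_ne (y := 0) (by
        simpa [h10, h20, sub_eq_zero] using hk)
      filter_upwards [hne] with r hr hA
      exact absurd (sub_eq_zero.2 hA) hr
  obtain ⟨η, hη, hball⟩ := Metric.eventually_nhds_iff_ball.1
    ((hgood.and (hcell.and (h1e.and h2e))).and (isOpen_Ioo.mem_nhds h0))
  rw [Real.ball_eq_Ioo, zero_sub, zero_add] at hball
  refine ⟨min η δ, ω₁, ω₂, lt_min hη hδ, min_le_right _ _, ?_⟩
  have hsub : ∀ τ ∈ Ioo (-(min η δ)) (min η δ), τ ∈ Ioo (-η) η := fun τ hτ =>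
    ⟨by linarith [hτ.1, min_le_left η δ], hτ.2.trans_le (min_le_left _ _)⟩
  refine ⟨fun τ hτ => (hball τ (hsub τ hτ)).1.2.2.1.contDiffWithinAt,
    fun τ hτ => (hball τ (hsub τ hτ)).1.2.2.2.contDiffWithinAt,
    fun τ hτ => (hball τ (hsub τ hτ)).1.1.2.2, ?_⟩
  intro τ hτ x y
  obtain ⟨⟨⟨g1, g2, -⟩, gc, -⟩, -⟩ := hball τ (hsub τ hτ)
  constructor
  · intro hA
    have hfr : A (Int.fract x • ω₁ τ + Int.fract y • ω₂ τ) (z + τ • u) = z + τ • u := by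
      rw [← h.mem_stabilizer] at hA ⊢
      have := sub_mem hA (hper τ g1 g2 ⌊x⌋ ⌊y⌋)
      convert this using 1
      simp only [Int.fract]
      module
    obtain ⟨⟨m, hm⟩, n, hn⟩ := gc (Int.fract x, Int.fract y)
      ⟨⟨Int.fract_nonneg x, (Int.fract_lt_one x).le⟩,
        ⟨Int.fract_nonneg y, (Int.fract_lt_one y).le⟩⟩ hfr
    refine ⟨⟨⌊x⌋ + m, ?_⟩, ⌊y⌋ + n, ?_⟩
    · push_cast
      rw [← hm]
      exact (Int.floor_add_fract x).symm
    · push_cast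
      rw [← hn]
      exact (Int.floor_add_fract y).symm
  · rintro ⟨⟨m, rfl⟩, n, rfl⟩
    exact h.mem_stabilizer.1 (hper τ g1 g2 m n)

end IsSurfaceAction

/-- Smooth functions on an open interval have smooth primitives. -/
theorem exists_primitive_contDiffOn {η : ℝ} {h : ℝ → ℝ} (hη : 0 < η)
    (hh : ContDiffOn ℝ ∞ h (Ioo (-η) η)) :
    ∃ H : ℝ → ℝ, ContDiffOn ℝ ∞ H (Ioo (-η) η) ∧ ∀ τ ∈ Ioo (-η) η, deriv H τ = h τ := by
  have hd : ∀ τ ∈ Ioo (-η) η, HasDerivAt (fun t => ∫ s in (0 : ℝ)..t, h s) (h τ) τ := by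
    intro τ hτ
    have hsub : uIcc 0 τ ⊆ Ioo (-η) η :=
      ordConnected_Ioo.uIcc_subset ⟨by linarith, hη⟩ hτ
    exact intervalIntegral.integral_hasDerivAt_right
      ((hh.continuousOn.mono hsub).intervalIntegrable)
      (hh.continuousOn.stronglyMeasurableAtFilter isOpen_Ioo τ hτ)
      (hh.continuousOn.continuousAt (isOpen_Ioo.mem_nhds hτ))
  refine ⟨fun t => ∫ s in (0 : ℝ)..t, h s, ?_, fun τ hτ => (hd τ hτ).deriv⟩
  rw [contDiffOn_infty_iff_deriv_of_isOpen isOpen_Ioo]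
  exact ⟨fun τ hτ => (hd τ hτ).differentiableAt.differentiableWithinAt,
    hh.congr fun τ hτ => (hd τ hτ).deriv⟩

/-- The tube around a transversal segment, with its orbits parametrised by moving frames. -/
def angleTube (A : ℝ × ℝ → R3 → R3) (z u : R3) (v₁ v₂ : ℝ → ℝ × ℝ) (q : R3) : R3 :=
  actionTube A z u (q 0, q 1 • v₁ (q 0) + q 2 • v₂ (q 0))

namespace IsSurfaceAction

variable {N : Set R3} {p : R3 → ℝ} {X Y : R3 → R3} {A : ℝ × ℝ → R3 → R3}

theorem apply_eq_apply_iff (h : IsSurfaceAction N p X Y A) (v w : ℝ × ℝ) (z : R3) :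
    A v z = A w z ↔ A (v - w) z = z := by
  constructor
  · intro hvw
    rw [sub_eq_neg_add, h.add, hvw, h.neg_apply]
  · intro hvw
    have : v = w + (v - w) := by abel
    rw [this, h.add, hvw]

theorem contDiffAt_angleTube (h : IsSurfaceAction N p X Y A) (z u : R3) {v₁ v₂ : ℝ → ℝ × ℝ}
    {q : R3} (h₁ : ContDiffAt ℝ ∞ v₁ (q 0)) (h₂ : ContDiffAt ℝ ∞ v₂ (q 0)) :
    ContDiffAt ℝ ∞ (angleTube A z u v₁ v₂) q := by
  have c : ∀ i, ContDiffAt ℝ ∞ (fun q : R3 => q i) q := fun i => by fun_prop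
  have c₁ : ContDiffAt ℝ ∞ (fun q : R3 => v₁ (q 0)) q := ContDiffAt.comp q h₁ (c 0)
  have c₂ : ContDiffAt ℝ ∞ (fun q : R3 => v₂ (q 0)) q := ContDiffAt.comp q h₂ (c 0)
  exact ContDiffAt.comp q (h.contDiff_tube z u).contDiffAt
    ((c 0).prodMk (((c 1).smul c₁).add ((c 2).smul c₂)))

theorem fderiv_angleTube (h : IsSurfaceAction N p X Y A) {z u : R3} {v₁ v₂ : ℝ → ℝ × ℝ}
    {q : R3} (h₁ : DifferentiableAt ℝ v₁ (q 0)) (h₂ : DifferentiableAt ℝ v₂ (q 0)) :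
    fderiv ℝ (angleTube A z u v₁ v₂) q =
      (fderiv ℝ (actionTube A z u) (q 0, q 1 • v₁ (q 0) + q 2 • v₂ (q 0))).comp
        ((EuclideanSpace.proj 0 : R3 →L[ℝ] ℝ).prod
          ((q 1 • (fderiv ℝ v₁ (q 0)).comp (EuclideanSpace.proj 0 : R3 →L[ℝ] ℝ) +
              (EuclideanSpace.proj 1 : R3 →L[ℝ] ℝ).smulRight (v₁ (q 0))) +
            (q 2 • (fderiv ℝ v₂ (q 0)).comp (EuclideanSpace.proj 0 : R3 →L[ℝ] ℝ) +
              (EuclideanSpace.proj 2 : R3 →L[ℝ] ℝ).smulRight (v₂ (q 0))))) := by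
  have c : ∀ i, HasFDerivAt (fun q : R3 => q i) (EuclideanSpace.proj i : R3 →L[ℝ] ℝ) q :=
    fun i => (EuclideanSpace.proj i : R3 →L[ℝ] ℝ).hasFDerivAt
  have c₁ := h₁.hasFDerivAt.comp q (c 0)
  have c₂ := h₂.hasFDerivAt.comp q (c 0)
  exact (((h.contDiff_tube z u).differentiable (by simp) _).hasFDerivAt.comp q
    ((c 0).prodMk (((c 1).smul c₁).add ((c 2).smul c₂)))).fderiv

theorem fderiv_angleTube_one (h : IsSurfaceAction N p X Y A) {z u : R3} {v₁ v₂ : ℝ → ℝ × ℝ}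
    {q : R3} (hq : z + q 0 • u ∈ N) (h₁ : DifferentiableAt ℝ v₁ (q 0))
    (h₂ : DifferentiableAt ℝ v₂ (q 0)) :
    fderiv ℝ (angleTube A z u v₁ v₂) q (e3 1) =
      (v₁ (q 0)).1 • X (angleTube A z u v₁ v₂ q) +
        (v₁ (q 0)).2 • Y (angleTube A z u v₁ v₂ q) := by
  rw [h.fderiv_angleTube h₁ h₂]
  have := h.fderiv_tube_inr (z := z) (u := u)
    (q := (q 0, q 1 • v₁ (q 0) + q 2 • v₂ (q 0))) hq (v₁ (q 0))
  simpa [e3, angleTube] using this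

theorem fderiv_angleTube_two (h : IsSurfaceAction N p X Y A) {z u : R3} {v₁ v₂ : ℝ → ℝ × ℝ}
    {q : R3} (hq : z + q 0 • u ∈ N) (h₁ : DifferentiableAt ℝ v₁ (q 0))
    (h₂ : DifferentiableAt ℝ v₂ (q 0)) :
    fderiv ℝ (angleTube A z u v₁ v₂) q (e3 2) =
      (v₂ (q 0)).1 • X (angleTube A z u v₁ v₂ q) +
        (v₂ (q 0)).2 • Y (angleTube A z u v₁ v₂ q) := by
  rw [h.fderiv_angleTube h₁ h₂]
  have := h.fderiv_tube_inr (z := z) (u := u)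
    (q := (q 0, q 1 • v₁ (q 0) + q 2 • v₂ (q 0))) hq (v₂ (q 0))
  simpa [e3, angleTube] using this

theorem fderiv_p_fderiv_angleTube_zero (h : IsSurfaceAction N p X Y A) {z u : R3}
    {v₁ v₂ : ℝ → ℝ × ℝ} {q : R3} (hq : z + q 0 • u ∈ N) (h₁ : DifferentiableAt ℝ v₁ (q 0))
    (h₂ : DifferentiableAt ℝ v₂ (q 0)) :
    fderiv ℝ p (angleTube A z u v₁ v₂ q) (fderiv ℝ (angleTube A z u v₁ v₂) q (e3 0)) =
      fderiv ℝ p (z + q 0 • u) u := by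
  rw [h.fderiv_angleTube h₁ h₂, ContinuousLinearMap.comp_apply]
  refine (h.fderiv_p_fderiv_tube (z := z) (u := u)
    (q := (q 0, q 1 • v₁ (q 0) + q 2 • v₂ (q 0))) hq _).trans ?_
  simp [e3]

/-- Smoothly varying angular frames of the orbits near a point with a lattice of periods. -/
theorem exists_angle_frames (h : IsSurfaceAction N p X Y A) {z u : R3} {δ : ℝ} (hδ : 0 < δ)
    (hN : ∀ τ ∈ Ioo (-δ) δ, z + τ • u ∈ N)
    (hd : ∀ τ ∈ Ioo (-δ) δ, fderiv ℝ p (z + τ • u) u ≠ 0)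
    (hmono : StrictMonoOn (fun τ : ℝ => p (z + τ • u)) (Ioo (-δ) δ)) {b₁ b₂ : ℝ × ℝ}
    (hb : b₁.1 * b₂.2 - b₁.2 * b₂.1 ≠ 0)
    (hlat : ∀ w, A w z = z ↔ ∃ m n : ℤ, w = (m : ℝ) • b₁ + (n : ℝ) • b₂) :
    ∃ (η : ℝ) (v₁ v₂ : ℝ → ℝ × ℝ), 0 < η ∧ η ≤ δ ∧
      ContDiffOn ℝ ∞ v₁ (Ioo (-η) η) ∧ ContDiffOn ℝ ∞ v₂ (Ioo (-η) η) ∧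
      (∀ τ ∈ Ioo (-η) η, (v₁ τ).1 * (v₂ τ).2 - (v₁ τ).2 * (v₂ τ).1 ≠ 0) ∧
      ∀ τ ∈ Ioo (-η) η, ∀ x y : ℝ, A (x • v₁ τ + y • v₂ τ) (z + τ • u) = z + τ • u ↔
        (∃ m : ℤ, x = 2 * Real.pi * m) ∧ ∃ n : ℤ, y = 2 * Real.pi * n := by
  obtain ⟨η, w₁, w₂, hη, hηδ, h₁, h₂, hdet, hper⟩ := h.exists_period_family hδ hN hd hmono hb hlat
  have hpi : (2 * Real.pi) ≠ 0 := by positivity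
  refine ⟨η, fun τ => (2 * Real.pi)⁻¹ • w₁ τ, fun τ => (2 * Real.pi)⁻¹ • w₂ τ, hη, hηδ,
    h₁.const_smul _, h₂.const_smul _, ?_, ?_⟩
  · intro τ hτ
    have h3 : ((2 * Real.pi)⁻¹ * (2 * Real.pi)⁻¹) *
        ((w₁ τ).1 * (w₂ τ).2 - (w₁ τ).2 * (w₂ τ).1) ≠ 0 :=
      mul_ne_zero (by positivity) (hdet τ hτ)
    convert h3 using 1
    simp only [Prod.smul_fst, Prod.smul_snd, smul_eq_mul]
    ring
  · intro τ hτ x y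
    have key : ∀ x : ℝ, (∃ m : ℤ, x * (2 * Real.pi)⁻¹ = m) ↔ ∃ m : ℤ, x = 2 * Real.pi * m := by
      intro x
      refine exists_congr fun m => ?_
      rw [← div_eq_mul_inv, div_eq_iff hpi, mul_comm]
    rw [smul_smul, smul_smul, hper τ hτ, key, key]

end IsSurfaceAction

theorem cross3_combo_right (x y : R3) (a b : ℝ) :
    cross3 x (a • x + b • y) = b • cross3 x y := by
  apply r3_ext <;> simp [cross3] <;> ring

theorem cross3_combo_left (x y : R3) (a b : ℝ) :
    cross3 (a • x + b • y) y = a • cross3 x y := by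
  apply r3_ext <;> simp [cross3] <;> ring

theorem cross3_combo (x y : R3) (a b c d : ℝ) :
    cross3 (a • x + b • y) (c • x + d • y) = (a * d - b * c) • cross3 x y := by
  apply r3_ext <;> simp [cross3] <;> ring

theorem linear_map_pt (L : R3 →L[ℝ] R3) (a b : ℝ) :
    L (pt 0 a b) = a • L (e3 1) + b • L (e3 2) := by
  rw [r3_eq_sum (pt 0 a b)]
  simp

/-- The commuting fields of an MHS integrable field generate a surface action near a regular
isolated level set. -/
theorem exists_surfaceAction {U : Set R3} {B : R3 → R3} {p : R3 → ℝ} (hU : IsOpen U)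
    (hB : ContDiffOn ℝ ∞ B U) (hp : ContDiffOn ℝ ∞ p U) (hBne : ∀ z ∈ U, B z ≠ 0)
    (hdiv : ∀ z ∈ U, divg B z = 0)
    (hMHS : ∀ z ∈ U, cross3 (curl B z) (B z) = gradient p z) {c : ℝ} {Λ : Set R3} {z₀ : R3}
    (hΛ : Λ = connectedComponentIn {z | z ∈ U ∧ p z = c} z₀) (hΛc : IsCompact Λ)
    (hreg : ∀ z ∈ Λ, gradient p z ≠ 0) :
    ∃ N A, IsSurfaceAction N p (fieldX B) (fieldY B p) A ∧ Λ ⊆ N ∧ N ⊆ U ∧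
      ∀ z ∈ N, p z = c → z ∈ Λ := by
  obtain ⟨N, A, hNo, hΛN, hNU, hgN, hNΛ, h0, hadd, hs, hmaps, hpA, hder⟩ :=
    exists_isolated_action hU hB hp hBne hdiv hMHS hΛ hΛc hreg
  refine ⟨N, A, ⟨hNo, hp.mono hNU, hgN, fun z hz => fderiv_fieldX hMHS (hNU hz),
    fun z _ => fderiv_fieldY z, ?_, h0, hadd, hs, hmaps, hpA, hder⟩, hΛN, hNU, hNΛ⟩
  intro z hz a b hab
  have hne : cross3 (fieldX B z) (fieldY B p z) ≠ 0 := by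
    rw [cross_fieldX_fieldY hMHS (hNU hz) (hBne z (hNU hz))]
    have := norm_ne_zero_iff.2 (hBne z (hNU hz))
    exact smul_ne_zero (neg_ne_zero.2 (by positivity)) (hgN z hz)
  have h1 := cross3_combo_left (fieldX B z) (fieldY B p z) a b
  have h2 := cross3_combo_right (fieldX B z) (fieldY B p z) a b
  rw [hab] at h1 h2
  have h3 : ∀ v : R3, cross3 0 v = 0 := fun v => by apply r3_ext <;> simp [cross3]
  have h4 : ∀ v : R3, cross3 v 0 = 0 := fun v => by apply r3_ext <;> simp [cross3]
  rw [h3, eq_comm, smul_eq_zero, or_iff_left hne] at h1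
  rw [h4, eq_comm, smul_eq_zero, or_iff_left hne] at h2
  exact ⟨h1, h2⟩

theorem det_of_frame {L : R3 →L[ℝ] R3} {x y g : R3} {a b c d r s : ℝ}
    (h1 : L (e3 1) = a • x + b • y) (h2 : L (e3 2) = c • x + d • y)
    (hxy : cross3 x y = r • g) (h0 : ⟪g, L (e3 0)⟫ = s) :
    LinearMap.det L.toLinearMap = (a * d - b * c) * r * s := by
  rw [det_r3, h1, h2, cross3_combo, hxy, smul_smul, inner_smul_right, real_inner_comm, h0]

theorem isOpen_image_of_det_ne_zero {S : Set R3} {Φ : R3 → R3} (hS : IsOpen S)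
    (hΦ : ContDiffOn ℝ ∞ Φ S)
    (hdet : ∀ q ∈ S, LinearMap.det (fderiv ℝ Φ q).toLinearMap ≠ 0) : IsOpen (Φ '' S) := by
  rw [isOpen_iff_mem_nhds]
  rintro _ ⟨q, hq, rfl⟩
  have h1 : HasStrictFDerivAt Φ (((fderiv ℝ Φ q).toContinuousLinearEquivOfDetNeZero
      (hdet q hq) : R3 ≃L[ℝ] R3) : R3 →L[ℝ] R3) q :=
    (hΦ.contDiffAt (hS.mem_nhds hq)).hasStrictFDerivAt (by simp)
  rw [← h1.map_nhds_eq_of_equiv]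
  exact image_mem_map (hS.mem_nhds hq)

theorem isOpen_slab (a b : ℝ) : IsOpen (Slab a b) :=
  isOpen_Ioo.preimage (by fun_prop : Continuous fun q : R3 => q 0)

end

/-- **Existence of Boozer coordinates near a regular flux surface**, for an MHS
integrable field: `div B = 0` and `(curl B) × B = ∇p` on `U`. -/
theorem boozer_near_regular_surface
    (U : Set R3) (B : R3 → R3) (p : R3 → ℝ)
    (hU : IsOpen U)
    (hB : ContDiffOn ℝ (⊤ : ℕ∞) B U) (hp : ContDiffOn ℝ (⊤ : ℕ∞) p U)
    (hBne : ∀ z ∈ U, B z ≠ 0)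
    (hdiv : ∀ z ∈ U, divg B z = 0)
    (hMHS : ∀ z ∈ U, cross3 (curl B z) (B z) = gradient p z)
    (c : ℝ) (Λ : Set R3) (z₀ : R3) (hz₀ : z₀ ∈ Λ)
    (hΛ : Λ = connectedComponentIn {z | z ∈ U ∧ p z = c} z₀)
    (hΛc : IsCompact Λ)
    (hreg : ∀ z ∈ Λ, gradient p z ≠ 0) :
    ∃ (ψ₁ ψ₂ : ℝ) (Φ : R3 → R3) (P f g k l : ℝ → ℝ),
      ψ₁ < ψ₂ ∧
      -- Φ is C^∞ on (ψ₁,ψ₂) × ℝ², with values in U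
      ContDiffOn ℝ (⊤ : ℕ∞) Φ (Slab ψ₁ ψ₂) ∧ (∀ q ∈ Slab ψ₁ ψ₂, Φ q ∈ U) ∧
      -- P, f, g, k, l are C^∞ on (ψ₁, ψ₂)
      ContDiffOn ℝ (⊤ : ℕ∞) P (Set.Ioo ψ₁ ψ₂) ∧
      ContDiffOn ℝ (⊤ : ℕ∞) f (Set.Ioo ψ₁ ψ₂) ∧
      ContDiffOn ℝ (⊤ : ℕ∞) g (Set.Ioo ψ₁ ψ₂) ∧
      ContDiffOn ℝ (⊤ : ℕ∞) k (Set.Ioo ψ₁ ψ₂) ∧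
      ContDiffOn ℝ (⊤ : ℕ∞) l (Set.Ioo ψ₁ ψ₂) ∧
      -- 2π-periodicity in each of the last two arguments
      (∀ ψ θ ζ : ℝ, Φ (pt ψ (θ + 2 * Real.pi) ζ) = Φ (pt ψ θ ζ)) ∧
      (∀ ψ θ ζ : ℝ, Φ (pt ψ θ (ζ + 2 * Real.pi)) = Φ (pt ψ θ ζ)) ∧
      -- everywhere invertible differential
      (∀ q ∈ Slab ψ₁ ψ₂, LinearMap.det (fderiv ℝ Φ q).toLinearMap ≠ 0) ∧
      -- image is an open neighborhood of Λ
      IsOpen (Φ '' Slab ψ₁ ψ₂) ∧ Λ ⊆ Φ '' Slab ψ₁ ψ₂ ∧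
      -- injectivity modulo 2π in the two angles
      (∀ q ∈ Slab ψ₁ ψ₂, ∀ q' ∈ Slab ψ₁ ψ₂,
        (Φ q = Φ q' ↔ (q 0 = q' 0 ∧
          (∃ m : ℤ, q 1 - q' 1 = 2 * Real.pi * (m : ℝ)) ∧
          (∃ n : ℤ, q 2 - q' 2 = 2 * Real.pi * (n : ℝ))))) ∧
      -- normal form: p ∘ Φ = P(ψ), and the pulled-back flux fields of B and B × ∇p are
      -- (0, g′(ψ), f′(ψ)) and (0, l′(ψ), k′(ψ)), expressed as DΦ(w) = det(DΦ) • (X ∘ Φ)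
      (∀ q ∈ Slab ψ₁ ψ₂,
        p (Φ q) = P (q 0) ∧
        (fderiv ℝ Φ q (pt 0 (deriv g (q 0)) (deriv f (q 0)))
          = LinearMap.det (fderiv ℝ Φ q).toLinearMap • B (Φ q)) ∧
        (fderiv ℝ Φ q (pt 0 (deriv l (q 0)) (deriv k (q 0)))
          = LinearMap.det (fderiv ℝ Φ q).toLinearMap •
              cross3 (B (Φ q)) (gradient p (Φ q)))) := by
  classical
  obtain ⟨N, A, hA, hΛN, hNU, hNΛ⟩ :=
    exists_surfaceAction hU hB hp hBne hdiv hMHS hΛ hΛc hreg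
  have hΛU : ∀ z ∈ Λ, p z = c := fun z hz =>
    (connectedComponentIn_subset _ _ (hΛ ▸ hz : z ∈ connectedComponentIn _ z₀)).2
  obtain ⟨b₁, b₂, hb, hlat, htrans⟩ := hA.exists_period_lattice
    (hΛ ▸ isPreconnected_connectedComponentIn) hΛc hΛN hΛU hNΛ hz₀
  obtain ⟨δ, hδ, hσN, hPd, hPmono⟩ := hA.exists_transversal (hΛN hz₀)
  obtain ⟨η, v₁, v₂, hη, hηδ, hv₁, hv₂, hdet, hper⟩ :=
    hA.exists_angle_frames hδ hσN hPd hPmono hb hlat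
  set u := gradient p z₀ with hu
  have hI : ∀ τ ∈ Set.Ioo (-η) η, τ ∈ Set.Ioo (-δ) δ := fun τ hτ =>
    ⟨by linarith [hτ.1], hτ.2.trans_le hηδ⟩
  let P : ℝ → ℝ := fun τ => p (z₀ + τ • u)
  let G : R3 → R3 := angleTube A z₀ u v₁ v₂
  let Φ : R3 → R3 := fun q => if q ∈ Slab (-η) η then G q else z₀
  have hΦ : ∀ q ∈ Slab (-η) η, Φ q = G q := fun q hq => if_pos hq
  have hΦev : ∀ q ∈ Slab (-η) η, Φ =ᶠ[nhds q] G := fun q hq =>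
    Filter.eventuallyEq_of_mem ((isOpen_slab _ _).mem_nhds hq) hΦ
  have hP : ContDiffOn ℝ (⊤ : ℕ∞) P (Set.Ioo (-η) η) :=
    hA.contDiffOn.comp (f := fun τ : ℝ => z₀ + τ • u) (by fun_prop) fun τ hτ => hσN τ (hI τ hτ)
  have hP' : ∀ τ ∈ Set.Ioo (-η) η, deriv P τ = fderiv ℝ p (z₀ + τ • u) u := by
    intro τ hτ
    have h2 : HasDerivAt (fun τ : ℝ => z₀ + τ • u) u τ := by
      simpa using ((hasDerivAt_id τ).smul_const u).const_add z₀
    exact (((hA.differentiableAt_p (hσN τ (hI τ hτ))).hasFDerivAt).comp_hasDerivAt τ h2).deriv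
  have hdP : ContDiffOn ℝ (⊤ : ℕ∞) (deriv P) (Set.Ioo (-η) η) :=
    hP.deriv_of_isOpen isOpen_Ioo (by rfl)
  obtain ⟨g, hg, hg'⟩ := exists_primitive_contDiffOn hη (hdP.mul hv₂.snd).neg
  obtain ⟨f, hf, hf'⟩ := exists_primitive_contDiffOn hη (hdP.mul hv₁.snd)
  obtain ⟨l, hl, hl'⟩ := exists_primitive_contDiffOn hη (hdP.mul hv₂.fst)
  obtain ⟨k, hk, hk'⟩ := exists_primitive_contDiffOn hη (hdP.mul hv₁.fst).neg
  have hat : ∀ {v : ℝ → ℝ × ℝ}, ContDiffOn ℝ (⊤ : ℕ∞) v (Set.Ioo (-η) η) →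
      ∀ q ∈ Slab (-η) η, ContDiffAt ℝ (⊤ : ℕ∞) v (q 0) := fun hv q hq =>
    hv.contDiffAt (isOpen_Ioo.mem_nhds hq)
  have hGN : ∀ q ∈ Slab (-η) η, G q ∈ N := fun q hq => hA.mapsTo _ _ (hσN _ (hI _ hq))
  have hG1 : ∀ q ∈ Slab (-η) η, fderiv ℝ Φ q (e3 1) =
      (v₁ (q 0)).1 • fieldX B (G q) + (v₁ (q 0)).2 • fieldY B p (G q) := fun q hq => by
    rw [(hΦev q hq).fderiv_eq]
    exact hA.fderiv_angleTube_one (hσN _ (hI _ hq)) ((hat hv₁ q hq).differentiableAt (by simp))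
      ((hat hv₂ q hq).differentiableAt (by simp))
  have hG2 : ∀ q ∈ Slab (-η) η, fderiv ℝ Φ q (e3 2) =
      (v₂ (q 0)).1 • fieldX B (G q) + (v₂ (q 0)).2 • fieldY B p (G q) := fun q hq => by
    rw [(hΦev q hq).fderiv_eq]
    exact hA.fderiv_angleTube_two (hσN _ (hI _ hq)) ((hat hv₁ q hq).differentiableAt (by simp))
      ((hat hv₂ q hq).differentiableAt (by simp))
  have hG0 : ∀ q ∈ Slab (-η) η, ⟪gradient p (G q), fderiv ℝ Φ q (e3 0)⟫ = deriv P (q 0) :=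
    fun q hq => by
      rw [inner_gradient, (hΦev q hq).fderiv_eq, hP' _ hq]
      exact hA.fderiv_p_fderiv_angleTube_zero (hσN _ (hI _ hq))
        ((hat hv₁ q hq).differentiableAt (by simp)) ((hat hv₂ q hq).differentiableAt (by simp))
  have hD : ∀ q ∈ Slab (-η) η, LinearMap.det (fderiv ℝ Φ q).toLinearMap =
      ((v₁ (q 0)).1 * (v₂ (q 0)).2 - (v₁ (q 0)).2 * (v₂ (q 0)).1) * (-(‖B (G q)‖ ^ 2)⁻¹) *
        deriv P (q 0) := fun q hq =>
    det_of_frame (hG1 q hq) (hG2 q hq)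
      (cross_fieldX_fieldY hMHS (hNU (hGN q hq)) (hBne _ (hNU (hGN q hq)))) (hG0 q hq)
  have hΦs : ContDiffOn ℝ (⊤ : ℕ∞) Φ (Slab (-η) η) := fun q hq =>
    ((hA.contDiffAt_angleTube z₀ u (hat hv₁ q hq) (hat hv₂ q hq)).congr_of_eventuallyEq
      (hΦev q hq)).contDiffWithinAt
  have hDne : ∀ q ∈ Slab (-η) η, LinearMap.det (fderiv ℝ Φ q).toLinearMap ≠ 0 := by
    intro q hq
    have := norm_ne_zero_iff.2 (hBne _ (hNU (hGN q hq)))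
    rw [hD q hq, hP' _ hq]
    exact mul_ne_zero (mul_ne_zero (hdet _ hq) (neg_ne_zero.2 (by positivity))) (hPd _ (hI _ hq))
  have hpG : ∀ q ∈ Slab (-η) η, p (G q) = P (q 0) := fun q hq =>
    hA.p_eq _ _ (hσN _ (hI _ hq))
  have hGeq : ∀ q ∈ Slab (-η) η, ∀ q' ∈ Slab (-η) η, (G q = G q' ↔ (q 0 = q' 0 ∧
      (∃ m : ℤ, q 1 - q' 1 = 2 * Real.pi * (m : ℝ)) ∧
      (∃ n : ℤ, q 2 - q' 2 = 2 * Real.pi * (n : ℝ)))) := by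
    intro q hq q' hq'
    have hsame : q 0 = q' 0 → (G q = G q' ↔
        (∃ m : ℤ, q 1 - q' 1 = 2 * Real.pi * (m : ℝ)) ∧
        (∃ n : ℤ, q 2 - q' 2 = 2 * Real.pi * (n : ℝ))) := by
      intro h0
      rw [← hper _ hq, show (q 1 - q' 1) • v₁ (q 0) + (q 2 - q' 2) • v₂ (q 0) =
        (q 1 • v₁ (q 0) + q 2 • v₂ (q 0)) - (q' 1 • v₁ (q 0) + q' 2 • v₂ (q 0)) by module,
        ← hA.apply_eq_apply_iff]
      simp only [G, angleTube, actionTube, h0]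
    constructor
    · intro hqq
      have h0 : q 0 = q' 0 := hPmono.injOn (hI _ hq) (hI _ hq') (by
        have := congrArg p hqq
        rwa [hpG q hq, hpG q' hq'] at this)
      exact ⟨h0, (hsame h0).1 hqq⟩
    · rintro ⟨h0, h12⟩
      exact (hsame h0).2 h12
  have hshift : ∀ q q' : R3, q 0 = q' 0 → (∃ m : ℤ, q 1 - q' 1 = 2 * Real.pi * (m : ℝ)) →
      (∃ n : ℤ, q 2 - q' 2 = 2 * Real.pi * (n : ℝ)) → Φ q = Φ q' := by
    intro q q' h0 h1 h2
    by_cases hq : q ∈ Slab (-η) η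
    · have hq' : q' ∈ Slab (-η) η := by
        change q' 0 ∈ Set.Ioo (-η) η
        rw [← h0]
        exact hq
      rw [hΦ q hq, hΦ q' hq']
      exact (hGeq q hq q' hq').2 ⟨h0, h1, h2⟩
    · have hq' : q' ∉ Slab (-η) η := by
        change ¬ q' 0 ∈ Set.Ioo (-η) η
        rw [← h0]
        exact hq
      exact (if_neg hq).trans (if_neg hq').symm
  refine ⟨-η, η, Φ, P, f, g, k, l, by linarith, hΦs, ?_, hP, hf, hg, hk, hl, ?_, ?_, hDne,
    isOpen_image_of_det_ne_zero (isOpen_slab _ _) hΦs hDne, ?_, ?_, ?_⟩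
  · intro q hq
    rw [hΦ q hq]
    exact hNU (hGN q hq)
  · intro ψ θ ζ
    exact hshift _ _ (by simp) ⟨1, by simp⟩ ⟨0, by simp⟩
  · intro ψ θ ζ
    exact hshift _ _ (by simp) ⟨0, by simp⟩ ⟨1, by simp⟩
  · intro y hy
    obtain ⟨w, rfl⟩ := htrans y hy
    have h0 : (0 : ℝ) ∈ Set.Ioo (-η) η := ⟨by linarith, hη⟩
    obtain ⟨x, y, rfl⟩ := exists_smul_add_smul_eq (hdet 0 h0) w
    have hq : pt 0 x y ∈ Slab (-η) η := by
      change pt 0 x y 0 ∈ Set.Ioo (-η) η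
      simpa using h0
    refine ⟨pt 0 x y, hq, ?_⟩
    rw [hΦ _ hq]
    simp [G, angleTube, actionTube]
  · intro q hq q' hq'
    rw [hΦ q hq, hΦ q' hq']
    exact hGeq q hq q' hq'
  · intro q hq
    rw [linear_map_pt, linear_map_pt, hG1 q hq, hG2 q hq, hD q hq, hΦ q hq, hg' _ hq, hf' _ hq,
      hl' _ hq, hk' _ hq]
    refine ⟨hpG q hq, ?_, ?_⟩
    · simp only [fieldX]
      module
    · simp only [fieldY]
      module
end
end

section
/- A Hamiltonian vector field is volume preserving iff it commutes with B (Lemma 3.4 in ℝ³): Let U ⊆ ℝ³ be open, B, X : U → ℝ³ continuously differentiable with div B = 0 on U, and H : U → ℝ twice continuously differentiable with B × X = ∇H on U. Then [X, B] = −(div X)·B at every point of U. Consequently, if in addition B is nowhere vanishing on U, then [X, B] = 0 on U if and only if div X = 0 on U. -/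
noncomputable section

open RealInnerProductSpace

/-- The coordinates of the gradient are the partial derivatives. -/
theorem gradient_apply_eq_fderiv_e3 (f : R3 → ℝ) (z : R3) (i : Fin 3) :
    gradient f z i = fderiv ℝ f z (e3 i) := by
  have h : ⟪gradient f z, e3 i⟫ = fderiv ℝ f z (e3 i) := by
    simp [gradient]
  rw [← h, e3, EuclideanSpace.inner_single_right]
  simp

/-- The divergence as the sum of the diagonal partial derivatives. -/
theorem divg_eq_sum (v : R3 → R3) (z : R3) :
    divg v z = fderiv ℝ v z (e3 0) 0 + fderiv ℝ v z (e3 1) 1 + fderiv ℝ v z (e3 2) 2 := by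
  unfold divg
  rw [LinearMap.trace_eq_sum_inner _ (EuclideanSpace.basisFun (Fin 3) ℝ)]
  simp [Fin.sum_univ_three, e3, EuclideanSpace.inner_single_left]

/-- A linear map on `ℝ³` is determined by its values on the standard basis. -/
theorem map_apply_eq_sum_e3 (L : R3 →L[ℝ] R3) (u : R3) (j : Fin 3) :
    L u j = u 0 * L (e3 0) j + u 1 * L (e3 1) j + u 2 * L (e3 2) j := by
  have hu : u = u 0 • e3 0 + u 1 • e3 1 + u 2 • e3 2 := by
    ext k
    fin_cases k <;> simp [e3]
  conv_lhs => rw [hu]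
  simp

/-- A coordinate of a differentiable vector field is differentiable. -/
theorem hasFDerivAt_coord {v : R3 → R3} {z : R3} (hv : DifferentiableAt ℝ v z) (i : Fin 3) :
    HasFDerivAt (fun w => v w i)
      ((EuclideanSpace.proj i : R3 →L[ℝ] ℝ).comp (fderiv ℝ v z)) z :=
  (EuclideanSpace.proj i : R3 →L[ℝ] ℝ).hasFDerivAt.comp z hv.hasFDerivAt

/-- The partial derivatives of a component `uᵢ vⱼ - uⱼ vᵢ` of a cross product. -/
theorem fderiv_coord_mul_sub {u v : R3 → R3} {z : R3} (hu : DifferentiableAt ℝ u z)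
    (hv : DifferentiableAt ℝ v z) (i j : Fin 3) (a : R3) :
    fderiv ℝ (fun w => u w i * v w j - u w j * v w i) z a =
      u z i * fderiv ℝ v z a j + v z j * fderiv ℝ u z a i -
        (u z j * fderiv ℝ v z a i + v z i * fderiv ℝ u z a j) := by
  have h := ((hasFDerivAt_coord hu i).mul (hasFDerivAt_coord hv j)).sub
    ((hasFDerivAt_coord hu j).mul (hasFDerivAt_coord hv i))
  have happ := congrArg (fun L : R3 →L[ℝ] ℝ => L a) h.fderiv
  exact happ.trans (by simp)

/-- The mixed second partial derivatives of a `C²` function agree. -/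
theorem fderiv_fderiv_e3_comm {f : R3 → ℝ} {z : R3} (hf : ContDiffAt ℝ 2 f z) (i j : Fin 3) :
    fderiv ℝ (fun w => fderiv ℝ f w (e3 j)) z (e3 i) =
      fderiv ℝ (fun w => fderiv ℝ f w (e3 i)) z (e3 j) := by
  have hd : DifferentiableAt ℝ (fderiv ℝ f) z :=
    (hf.fderiv_right (m := 1) (by norm_num)).differentiableAt (by norm_num)
  have hs : IsSymmSndFDerivAt ℝ f z := hf.isSymmSndFDerivAt (by simp)
  have key : ∀ a b : R3, fderiv ℝ (fun w => fderiv ℝ f w a) z b =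
      fderiv ℝ (fderiv ℝ f) z b a := by
    intro a b
    rw [fderiv_clm_apply hd (differentiableAt_const a)]
    simp
  rw [key, key]
  exact hs _ _

/-- The curl of `B × X = ∇H` vanishes, which expresses the Lie bracket of `X` and a
divergence-free `B` through the divergence of `X`. -/
theorem bracket_eq_neg_divg_smul {B X : R3 → R3} {H : R3 → ℝ} {z : R3}
    (hB : DifferentiableAt ℝ B z) (hX : DifferentiableAt ℝ X z) (hH : ContDiffAt ℝ 2 H z)
    (hdivB : divg B z = 0) (hBX : ∀ᶠ w in nhds z, cross3 (B w) (X w) = gradient H w) :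
    fderiv ℝ B z (X z) - fderiv ℝ X z (B z) = -(divg X z) • B z := by
  have h0 : (fun w => fderiv ℝ H w (e3 0)) =ᶠ[nhds z]
      fun w => B w 1 * X w 2 - B w 2 * X w 1 := by
    filter_upwards [hBX] with w hw
    rw [← gradient_apply_eq_fderiv_e3, ← hw]
    simp [cross3, pt]
  have h1 : (fun w => fderiv ℝ H w (e3 1)) =ᶠ[nhds z]
      fun w => B w 2 * X w 0 - B w 0 * X w 2 := by
    filter_upwards [hBX] with w hw
    rw [← gradient_apply_eq_fderiv_e3, ← hw]
    simp [cross3, pt]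
  have h2 : (fun w => fderiv ℝ H w (e3 2)) =ᶠ[nhds z]
      fun w => B w 0 * X w 1 - B w 1 * X w 0 := by
    filter_upwards [hBX] with w hw
    rw [← gradient_apply_eq_fderiv_e3, ← hw]
    simp [cross3, pt]
  have s01 := fderiv_fderiv_e3_comm hH 0 1
  have s02 := fderiv_fderiv_e3_comm hH 0 2
  have s12 := fderiv_fderiv_e3_comm hH 1 2
  rw [h0.fderiv_eq, h1.fderiv_eq, fderiv_coord_mul_sub hB hX, fderiv_coord_mul_sub hB hX] at s01
  rw [h0.fderiv_eq, h2.fderiv_eq, fderiv_coord_mul_sub hB hX, fderiv_coord_mul_sub hB hX] at s02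
  rw [h1.fderiv_eq, h2.fderiv_eq, fderiv_coord_mul_sub hB hX, fderiv_coord_mul_sub hB hX] at s12
  rw [divg_eq_sum] at hdivB
  ext j
  simp only [PiLp.sub_apply, PiLp.smul_apply, smul_eq_mul, divg_eq_sum X]
  rw [map_apply_eq_sum_e3 _ (X z), map_apply_eq_sum_e3 _ (B z)]
  fin_cases j
  · simp only [Fin.zero_eta]
    linear_combination s12 + X z 0 * hdivB
  · simp only [Fin.mk_one]
    linear_combination -s02 + X z 1 * hdivB
  · simp only [Fin.reduceFinMk]
    linear_combination s01 + X z 2 * hdivB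

/-- **A Hamiltonian vector field is volume preserving iff it commutes with `B`**
(Lemma 3.4 in ℝ³): if `div B = 0` and `B × X = ∇H` on `U`, then
`[X, B] = −(div X)·B` on `U`; consequently, when `B` is nowhere vanishing,
`[X, B] = 0` on `U` iff `div X = 0` on `U`. -/
theorem hamiltonian_field_volume_preserving_iff_commutes
    (U : Set R3) (hU : IsOpen U)
    (B X : R3 → R3) (H : R3 → ℝ)
    (hB : ContDiffOn ℝ 1 B U) (hX : ContDiffOn ℝ 1 X U)
    (hH : ContDiffOn ℝ 2 H U)
    (hdivB : ∀ z ∈ U, divg B z = 0)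
    (hBX : ∀ z ∈ U, cross3 (B z) (X z) = gradient H z) :
    (∀ z ∈ U,
      (fderiv ℝ B z) (X z) - (fderiv ℝ X z) (B z) = -(divg X z) • B z) ∧
    ((∀ z ∈ U, B z ≠ 0) →
      ((∀ z ∈ U, (fderiv ℝ B z) (X z) - (fderiv ℝ X z) (B z) = 0) ↔
        (∀ z ∈ U, divg X z = 0))) := by
  have main : ∀ z ∈ U,
      (fderiv ℝ B z) (X z) - (fderiv ℝ X z) (B z) = -(divg X z) • B z := by
    intro z hz
    have hn : U ∈ nhds z := hU.mem_nhds hz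
    exact bracket_eq_neg_divg_smul ((hB.contDiffAt hn).differentiableAt (by norm_num))
      ((hX.contDiffAt hn).differentiableAt (by norm_num)) (hH.contDiffAt hn) (hdivB z hz)
      (Filter.mem_of_superset hn hBX)
  refine ⟨main, fun hne => forall₂_congr fun z hz => ?_⟩
  rw [main z hz, smul_eq_zero, neg_eq_zero, or_iff_left (hne z hz)]
end
end
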